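/- arXiv:0907.1350 — 2 statements merged into one kernel-verified Lean document; each statement's English description precedes it below -/
import Mathlib

section
/- Let p be an odd prime and q = p^a with q ≡ 3 (mod 4) and q ∉ {7, 11, 19, 23, 59}. Let K = 𝔽_q((u)), O = 𝔽_q[[u]], and let P₁, P₂ and B = P₁ ∩ P₂ be the standard parahoric and Iwahori subgroups of SL₂(K). Suppose A₁ ≤ P₁ and A₂ ≤ P₂ are finite subgroups such that, for i = 1,2: every element of P_i can be written as a·b with a ∈ A_i and b ∈ B, and A_i ∩ P_{3-i} = A₁ ∩ A₂. Then -I ∈ A_i, each A_i has order 2(q+1), A₁ ∩ A₂ = {I, -I}, and A_i/⟨-I⟩ is isomorphic to the dihedral group of order q+1 for i = 1,2. -/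
instance : Fact (Even (Fintype.card (Fin 2))) := ⟨⟨1, rfl⟩⟩

/-- The valuation ring `O = 𝔽_q[[u]]` of `K = 𝔽_q((u))`, regarded as a subring of `K`
(the image of the ring of formal power series). -/
noncomputable def laurentIntegers (F : Type*) [Field F] : Subring (LaurentSeries F) :=
  (HahnSeries.ofPowerSeries ℤ F).range

/-- The uniformiser `u` of `K = 𝔽_q((u))`. -/
noncomputable def laurentVar (F : Type*) [Field F] : LaurentSeries F :=
  HahnSeries.ofPowerSeries ℤ F PowerSeries.X

/-- The standard parahoric subgroup `P₁` of `SL₂(K)`: matrices all of whose entries lie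
in `O`. -/
def parahoricOne (F : Type*) [Field F] :
    Set (Matrix.SpecialLinearGroup (Fin 2) (LaurentSeries F)) :=
  {g | ∀ i j : Fin 2, (↑g : Matrix (Fin 2) (Fin 2) (LaurentSeries F)) i j ∈
    laurentIntegers F}

/-- The standard parahoric subgroup `P₂` of `SL₂(K)`: matrices whose diagonal entries lie
in `O`, with `u` times the top-right entry in `O`, and bottom-left entry in `u·O`. -/
def parahoricTwo (F : Type*) [Field F] :
    Set (Matrix.SpecialLinearGroup (Fin 2) (LaurentSeries F)) :=
  {g | (↑g : Matrix (Fin 2) (Fin 2) (LaurentSeries F)) 0 0 ∈ laurentIntegers F ∧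
       (↑g : Matrix (Fin 2) (Fin 2) (LaurentSeries F)) 1 1 ∈ laurentIntegers F ∧
       laurentVar F * (↑g : Matrix (Fin 2) (Fin 2) (LaurentSeries F)) 0 1 ∈
         laurentIntegers F ∧
       ∃ y ∈ laurentIntegers F,
         (↑g : Matrix (Fin 2) (Fin 2) (LaurentSeries F)) 1 0 = laurentVar F * y}

/-- The Iwahori subgroup `B = P₁ ∩ P₂`. -/
def iwahori (F : Type*) [Field F] :
    Set (Matrix.SpecialLinearGroup (Fin 2) (LaurentSeries F)) :=
  parahoricOne F ∩ parahoricTwo F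

open Matrix MatrixGroups

/-! ### The valuation ring `F⟦u⟧` of `F((u))` -/

section LaurentIntegers

variable {F : Type*} [Field F]

lemma laurentVar_ne_zero : laurentVar F ≠ 0 := by
  rw [laurentVar, Ne, map_eq_zero_iff _ HahnSeries.ofPowerSeries_injective]
  exact PowerSeries.X_ne_zero

lemma laurentVar_mem : laurentVar F ∈ laurentIntegers F := ⟨_, rfl⟩

lemma laurentVar_mul_ne_one {y : LaurentSeries F} (hy : y ∈ laurentIntegers F) :
    laurentVar F * y ≠ 1 := by
  obtain ⟨f, rfl⟩ := hy
  rw [laurentVar, ← map_mul, ← map_one (HahnSeries.ofPowerSeries ℤ F)]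
  intro h
  have := congrArg PowerSeries.constantCoeff (HahnSeries.ofPowerSeries_injective h)
  simp at this

/-- An integral element that is not a multiple of the uniformiser is a unit. -/
lemma laurentIntegers_inv_mem {x : LaurentSeries F} (hx : x ∈ laurentIntegers F)
    (h : ∀ y ∈ laurentIntegers F, x ≠ laurentVar F * y) :
    x ≠ 0 ∧ x⁻¹ ∈ laurentIntegers F := by
  have hx0 : x ≠ 0 := by
    rintro rfl
    exact h 0 (Subring.zero_mem _) (by simp)
  refine ⟨hx0, ?_⟩
  obtain ⟨f, rfl⟩ := hx
  have hf : IsUnit f := by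
    rw [PowerSeries.isUnit_iff_constantCoeff, isUnit_iff_ne_zero]
    intro h0
    obtain ⟨g, rfl⟩ := PowerSeries.X_dvd_iff.2 h0
    exact h _ ⟨g, rfl⟩ (map_mul _ _ _)
  obtain ⟨g, hg⟩ := hf.exists_right_inv
  exact ⟨g, eq_inv_of_mul_eq_one_right (by rw [← map_mul, hg, map_one])⟩

lemma eq_zero_of_laurentVar_pow_dvd {x : LaurentSeries F} {S : Set ℕ} (hS : S.Infinite)
    (h : ∀ n ∈ S, ∃ y ∈ laurentIntegers F, x = laurentVar F ^ n * y) : x = 0 := by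
  obtain ⟨n₀, hn₀⟩ := hS.nonempty
  obtain ⟨f, hf⟩ : x ∈ laurentIntegers F := by
    obtain ⟨y, hy, rfl⟩ := h n₀ hn₀
    exact Subring.mul_mem _ (Subring.pow_mem _ laurentVar_mem _) hy
  suffices f = 0 by rw [← hf, this, map_zero]
  ext m
  obtain ⟨n, hn, hmn⟩ := hS.exists_gt m
  obtain ⟨_, ⟨g, rfl⟩, hg⟩ := h n hn
  have : f = PowerSeries.X ^ n * g := by
    apply HahnSeries.ofPowerSeries_injective (Γ := ℤ)
    rw [hf, hg, map_mul, map_pow, laurentVar]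
  exact PowerSeries.X_pow_dvd_iff.1 ⟨g, this⟩ m hmn

end LaurentIntegers

/-! ### The parahoric subgroups -/

section Parahoric

variable {F : Type*} [Field F]

/-- Conjugation by `!![0, 1; -u, 0]` on `SL₂(K)`. -/
def conjAntidiagonal {K : Type*} [Field K] {u : K} (hu : u ≠ 0) : SL(2, K) ≃* SL(2, K) where
  toFun g := ⟨!![g 1 1, -(g 1 0) / u; -u * g 0 1, g 0 0], by
    have h := g.det_coe
    rw [Matrix.det_fin_two] at h
    rw [Matrix.det_fin_two_of]
    field_simp
    linear_combination h⟩
  invFun g := ⟨!![g 1 1, -(g 1 0) / u; -u * g 0 1, g 0 0], by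
    have h := g.det_coe
    rw [Matrix.det_fin_two] at h
    rw [Matrix.det_fin_two_of]
    field_simp
    linear_combination h⟩
  left_inv g := by
    ext i j
    fin_cases i <;> fin_cases j <;> simp <;> field_simp
  right_inv g := by
    ext i j
    fin_cases i <;> fin_cases j <;> simp <;> field_simp
  map_mul' g h := by
    refine Subtype.ext ?_
    change !![(g * h : SL(2, K)) 1 1, -((g * h : SL(2, K)) 1 0) / u;
      -u * (g * h : SL(2, K)) 0 1, (g * h : SL(2, K)) 0 0] =
      !![g 1 1, -(g 1 0) / u; -u * g 0 1, g 0 0] * !![h 1 1, -(h 1 0) / u; -u * h 0 1, h 0 0]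
    simp only [Matrix.SpecialLinearGroup.coe_mul, Matrix.mul_apply, Fin.sum_univ_two]
    ext i j
    fin_cases i <;> fin_cases j <;> simp <;> field_simp <;> ring

/-- The automorphism of `SL₂(F((u)))` given by conjugation by an element of `GL₂` that
interchanges the two parahoric subgroups. -/
noncomputable def parahoricSwap (F : Type*) [Field F] :
    SL(2, LaurentSeries F) ≃* SL(2, LaurentSeries F) :=
  conjAntidiagonal laurentVar_ne_zero

lemma parahoricSwap_swap (g : SL(2, LaurentSeries F)) :
    parahoricSwap F (parahoricSwap F g) = g :=
  (parahoricSwap F).left_inv g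

lemma parahoricSwap_mem_two {g : SL(2, LaurentSeries F)} (hg : g ∈ parahoricOne F) :
    parahoricSwap F g ∈ parahoricTwo F := by
  refine ⟨hg 1 1, hg 0 0, ?_, -(g 0 1), Subring.neg_mem _ (hg 0 1), ?_⟩
  · change laurentVar F * (-(g 1 0) / laurentVar F) ∈ laurentIntegers F
    rw [mul_div_cancel₀ _ laurentVar_ne_zero]
    exact Subring.neg_mem _ (hg 1 0)
  · change -(laurentVar F) * g 0 1 = _
    ring

lemma parahoricSwap_mem_one {g : SL(2, LaurentSeries F)} (hg : g ∈ parahoricTwo F) :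
    parahoricSwap F g ∈ parahoricOne F := by
  obtain ⟨h00, h11, h01, y, hy, h10⟩ := hg
  intro i j
  fin_cases i <;> fin_cases j
  · exact h11
  · change -(g 1 0) / laurentVar F ∈ laurentIntegers F
    rw [h10, neg_div, mul_div_cancel_left₀ _ laurentVar_ne_zero]
    exact Subring.neg_mem _ hy
  · change -(laurentVar F) * g 0 1 ∈ laurentIntegers F
    rw [neg_mul]
    exact Subring.neg_mem _ h01
  · exact h00

lemma parahoricSwap_mem_one_iff {g : SL(2, LaurentSeries F)} :
    parahoricSwap F g ∈ parahoricOne F ↔ g ∈ parahoricTwo F :=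
  ⟨fun h ↦ parahoricSwap_swap g ▸ parahoricSwap_mem_two h, parahoricSwap_mem_one⟩

lemma parahoricSwap_mem_two_iff {g : SL(2, LaurentSeries F)} :
    parahoricSwap F g ∈ parahoricTwo F ↔ g ∈ parahoricOne F :=
  ⟨fun h ↦ parahoricSwap_swap g ▸ parahoricSwap_mem_one h, parahoricSwap_mem_two⟩

lemma parahoricSwap_mem_iwahori {g : SL(2, LaurentSeries F)} (hg : g ∈ iwahori F) :
    parahoricSwap F g ∈ iwahori F :=
  ⟨parahoricSwap_mem_one hg.2, parahoricSwap_mem_two hg.1⟩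

lemma parahoricOne_eq_range :
    parahoricOne F =
      ↑((Matrix.SpecialLinearGroup.map (n := Fin 2) (HahnSeries.ofPowerSeries ℤ F)).range :
      Subgroup SL(2, LaurentSeries F)) := by
  ext g
  constructor
  · intro hg
    choose f hf using hg
    refine ⟨⟨Matrix.of f, HahnSeries.ofPowerSeries_injective (Γ := ℤ) ?_⟩, ?_⟩
    · rw [RingHom.map_det, map_one, ← g.det_coe]
      congr 1
      ext1 i j
      exact hf i j
    · ext1 i j
      exact hf i j
  · rintro ⟨f, rfl⟩ i j
    exact ⟨f i j, rfl⟩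

lemma parahoricOne_mul_mem {g h : SL(2, LaurentSeries F)} (hg : g ∈ parahoricOne F)
    (hh : h ∈ parahoricOne F) : g * h ∈ parahoricOne F := by
  rw [parahoricOne_eq_range] at *
  exact mul_mem hg hh

lemma parahoricOne_inv_mem {g : SL(2, LaurentSeries F)} (hg : g ∈ parahoricOne F) :
    g⁻¹ ∈ parahoricOne F := by
  rw [parahoricOne_eq_range] at *
  exact inv_mem hg

lemma parahoricTwo_mul_mem {g h : SL(2, LaurentSeries F)} (hg : g ∈ parahoricTwo F)
    (hh : h ∈ parahoricTwo F) : g * h ∈ parahoricTwo F := by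
  rw [← parahoricSwap_mem_one_iff] at *
  rw [map_mul]
  exact parahoricOne_mul_mem hg hh

lemma parahoricTwo_inv_mem {g : SL(2, LaurentSeries F)} (hg : g ∈ parahoricTwo F) :
    g⁻¹ ∈ parahoricTwo F := by
  rw [← parahoricSwap_mem_one_iff] at *
  rw [map_inv]
  exact parahoricOne_inv_mem hg

end Parahoric

/-! ### Alternating products in two subgroups -/

section Alternating

variable {G : Type*} [Group G]

/-- Products `a₁ a₂ ⋯ aₙ`, `n ≥ 1`, whose factors lie alternately in `A \ B` and `B \ A`,
the first one being in `A \ B`. -/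
inductive IsAlternating : Subgroup G → Subgroup G → G → Prop
  | of {A B : Subgroup G} {a : G} : a ∈ A → a ∉ B → IsAlternating A B a
  | mul {A B : Subgroup G} {a g : G} :
      a ∈ A → a ∉ B → IsAlternating B A g → IsAlternating A B (a * g)

lemma IsAlternating.inf_mul {A B : Subgroup G} {c g : G} (hA : c ∈ A) (hB : c ∈ B)
    (hg : IsAlternating A B g) : IsAlternating A B (c * g) := by
  cases hg with
  | of ha hb => exact .of (mul_mem hA ha) (by rwa [Subgroup.mul_mem_cancel_left _ hB])
  | mul ha hb h =>
    rw [← mul_assoc]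
    exact .mul (mul_mem hA ha) (by rwa [Subgroup.mul_mem_cancel_left _ hB]) h

lemma IsAlternating.left_mul {A B : Subgroup G} {a g : G} (ha : a ∈ A)
    (hg : g ∈ A ⊓ B ∨ IsAlternating A B g ∨ IsAlternating B A g) :
    a * g ∈ A ⊓ B ∨ IsAlternating A B (a * g) ∨ IsAlternating B A (a * g) := by
  have key : ∀ x ∈ A, x ∈ A ⊓ B ∨ IsAlternating A B x := fun x hx ↦ by
    by_cases hxB : x ∈ B
    · exact .inl ⟨hx, hxB⟩
    · exact .inr (.of hx hxB)
  rcases hg with hg | hg | hg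
  · rcases key _ (mul_mem ha hg.1) with h | h
    exacts [.inl h, .inr (.inl h)]
  · cases hg with
    | of hx _ =>
      rcases key _ (mul_mem ha hx) with h | h
      exacts [.inl h, .inr (.inl h)]
    | @mul _ _ x y hx _ h =>
      rw [← mul_assoc]
      by_cases hax : a * x ∈ B
      · exact .inr (.inr (h.inf_mul hax (mul_mem ha hx)))
      · exact .inr (.inl (.mul (mul_mem ha hx) hax h))
  · by_cases haB : a ∈ B
    · exact .inr (.inr (hg.inf_mul haB ha))
    · exact .inr (.inl (.mul ha haB hg))

lemma mem_inf_or_isAlternating {A B : Subgroup G} {g : G} (hg : g ∈ A ⊔ B) :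
    g ∈ A ⊓ B ∨ IsAlternating A B g ∨ IsAlternating B A g := by
  have step : ∀ x ∈ (A : Set G) ∪ B, ∀ y,
      (y ∈ A ⊓ B ∨ IsAlternating A B y ∨ IsAlternating B A y) →
      (x * y ∈ A ⊓ B ∨ IsAlternating A B (x * y) ∨ IsAlternating B A (x * y)) := by
    rintro x (hx | hx) y hy
    · exact IsAlternating.left_mul hx hy
    · have := IsAlternating.left_mul (A := B) (B := A) (a := x) (g := y) hx
        (by rw [inf_comm]; tauto)
      rw [inf_comm] at this
      tauto
  rw [← Subgroup.closure_eq A, ← Subgroup.closure_eq B, ← Subgroup.closure_union] at hg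
  induction hg using Subgroup.closure_induction_left with
  | one => exact .inl (one_mem _)
  | mul_left x hx y _ ih => exact step x hx y ih
  | inv_mul_cancel x hx y _ ih =>
    exact step x⁻¹ (hx.imp A.inv_mem B.inv_mem) y ih

end Alternating

/-! ### Edge-transitive pairs of subgroups -/

section EdgeTransitive

variable {F : Type*} [Field F]

/-- Subgroups `A₁`, `A₂` of the two parahoric subgroups, each transitive on the corresponding
cosets of the Iwahori subgroup and such that `A₁` and `A₂` meet the other parahoric subgroup
in `A₁ ∩ A₂`. -/
structure IsEdgeTransitivePair (A₁ A₂ : Subgroup SL(2, LaurentSeries F)) : Prop where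
  mem_one : ∀ g ∈ A₁, g ∈ parahoricOne F
  mem_two : ∀ g ∈ A₂, g ∈ parahoricTwo F
  cover_one : ∀ g ∈ parahoricOne F, ∃ x ∈ A₁, ∃ b ∈ iwahori F, g = x * b
  cover_two : ∀ g ∈ parahoricTwo F, ∃ x ∈ A₂, ∃ b ∈ iwahori F, g = x * b
  inter_one : ∀ g ∈ A₁, g ∈ parahoricTwo F → g ∈ A₂
  inter_two : ∀ g ∈ A₂, g ∈ parahoricOne F → g ∈ A₁

lemma IsEdgeTransitivePair.swap {A₁ A₂ : Subgroup SL(2, LaurentSeries F)}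
    (h : IsEdgeTransitivePair A₁ A₂) :
    IsEdgeTransitivePair (A₂.map (parahoricSwap F).toMonoidHom)
      (A₁.map (parahoricSwap F).toMonoidHom) where
  mem_one := by
    rintro _ ⟨g, hg, rfl⟩
    exact parahoricSwap_mem_one (h.mem_two g hg)
  mem_two := by
    rintro _ ⟨g, hg, rfl⟩
    exact parahoricSwap_mem_two (h.mem_one g hg)
  cover_one g hg := by
    obtain ⟨x, hx, b, hb, hxb⟩ := h.cover_two _ (parahoricSwap_mem_two hg)
    refine ⟨_, ⟨x, hx, rfl⟩, _, parahoricSwap_mem_iwahori hb, ?_⟩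
    rw [← parahoricSwap_swap g, hxb]
    exact map_mul (parahoricSwap F) x b
  cover_two g hg := by
    obtain ⟨x, hx, b, hb, hxb⟩ := h.cover_one _ (parahoricSwap_mem_one hg)
    refine ⟨_, ⟨x, hx, rfl⟩, _, parahoricSwap_mem_iwahori hb, ?_⟩
    rw [← parahoricSwap_swap g, hxb]
    exact map_mul (parahoricSwap F) x b
  inter_one := by
    rintro _ ⟨g, hg, rfl⟩ hg'
    exact ⟨g, h.inter_two g hg (parahoricSwap_mem_two_iff.1 hg'), rfl⟩
  inter_two := by
    rintro _ ⟨g, hg, rfl⟩ hg'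
    exact ⟨g, h.inter_one g hg (parahoricSwap_mem_one_iff.1 hg'), rfl⟩

lemma laurentIntegers_add_inv_mem {a z : LaurentSeries F} (ha : a ∈ laurentIntegers F)
    (ha0 : a ≠ 0) (hai : a⁻¹ ∈ laurentIntegers F) (hz : z ∈ laurentIntegers F) :
    a + laurentVar F * z ≠ 0 ∧ (a + laurentVar F * z)⁻¹ ∈ laurentIntegers F := by
  refine laurentIntegers_inv_mem (add_mem ha (mul_mem laurentVar_mem hz)) fun y hy h ↦ ?_
  refine laurentVar_mul_ne_one (mul_mem (sub_mem hy hz) hai) ?_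
  field_simp
  linear_combination -h

lemma inv_mem_of_mem_parahoricOne {g : SL(2, LaurentSeries F)} (hg : g ∈ parahoricOne F)
    (hg' : g ∉ parahoricTwo F) : g 1 0 ≠ 0 ∧ (g 1 0)⁻¹ ∈ laurentIntegers F :=
  laurentIntegers_inv_mem (hg 1 0) fun y hy h ↦
    hg' ⟨hg 0 0, hg 1 1, mul_mem laurentVar_mem (hg 0 1), y, hy, h⟩

lemma inv_mem_of_mem_parahoricTwo {g : SL(2, LaurentSeries F)} (hg : g ∈ parahoricTwo F)
    (hg' : g ∉ parahoricOne F) :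
    laurentVar F * g 0 1 ≠ 0 ∧ (laurentVar F * g 0 1)⁻¹ ∈ laurentIntegers F := by
  refine laurentIntegers_inv_mem hg.2.2.1 fun y hy h ↦ hg' ?_
  obtain ⟨h00, h11, -, z, hz, h10⟩ := hg
  intro i j
  fin_cases i <;> fin_cases j
  · exact h00
  · change g 0 1 ∈ _
    rwa [mul_left_cancel₀ laurentVar_ne_zero h]
  · change g 1 0 ∈ _
    rw [h10]
    exact mul_mem laurentVar_mem hz
  · exact h11

/-- A column of `g` whose second entry dominates, which is not a column of an Iwahori matrix. -/
def LowerExpanding (g : SL(2, LaurentSeries F)) : Prop :=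
  ∃ j, g 1 j ≠ 0 ∧ g 0 j * (g 1 j)⁻¹ ∈ laurentIntegers F ∧ (g 1 j)⁻¹ ∈ laurentIntegers F ∧
    (j = 0 ∨ (laurentVar F * g 1 j)⁻¹ ∈ laurentIntegers F)

/-- A column of `g` whose first entry dominates, which is not a column of an Iwahori matrix. -/
def UpperExpanding (g : SL(2, LaurentSeries F)) : Prop :=
  ∃ j, g 0 j ≠ 0 ∧ g 1 j * (laurentVar F * g 0 j)⁻¹ ∈ laurentIntegers F ∧
    (laurentVar F * g 0 j)⁻¹ ∈ laurentIntegers F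

lemma LowerExpanding.notMem_iwahori {g : SL(2, LaurentSeries F)} (hg : LowerExpanding g) :
    g ∉ iwahori F := by
  rintro ⟨h₁, -, -, -, y, hy, h10⟩
  obtain ⟨j, hne, -, hinv, rfl | hu⟩ := hg
  · refine laurentVar_mul_ne_one (mul_mem hy hinv) ?_
    rw [← mul_assoc, ← h10, mul_inv_cancel₀ hne]
  · refine laurentVar_mul_ne_one (mul_mem (h₁ 1 j) hu) ?_
    rw [← mul_assoc, mul_inv_cancel₀ (mul_ne_zero laurentVar_ne_zero hne)]

lemma UpperExpanding.notMem_iwahori {g : SL(2, LaurentSeries F)} (hg : UpperExpanding g) :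
    g ∉ iwahori F := by
  rintro ⟨h₁, -⟩
  obtain ⟨j, hne, -, hu⟩ := hg
  refine laurentVar_mul_ne_one (mul_mem (h₁ 0 j) hu) ?_
  rw [← mul_assoc, mul_inv_cancel₀ (mul_ne_zero laurentVar_ne_zero hne)]

lemma LowerExpanding.of_mem {a : SL(2, LaurentSeries F)} (ha : a ∈ parahoricOne F)
    (ha' : a ∉ parahoricTwo F) : LowerExpanding a := by
  obtain ⟨h0, h⟩ := inv_mem_of_mem_parahoricOne ha ha'
  exact ⟨0, h0, mul_mem (ha 0 0) h, h, .inl rfl⟩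

lemma UpperExpanding.of_mem {a : SL(2, LaurentSeries F)} (ha : a ∈ parahoricTwo F)
    (ha' : a ∉ parahoricOne F) : UpperExpanding a := by
  obtain ⟨h0, h⟩ := inv_mem_of_mem_parahoricTwo ha ha'
  exact ⟨1, right_ne_zero_of_mul h0, mul_mem ha.2.1 h, h⟩

lemma LowerExpanding.mul {a g : SL(2, LaurentSeries F)} (ha : a ∈ parahoricOne F)
    (ha' : a ∉ parahoricTwo F) (hg : UpperExpanding g) : LowerExpanding (a * g) := by
  obtain ⟨h0, h⟩ := inv_mem_of_mem_parahoricOne ha ha'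
  obtain ⟨j, hne, hy, hu⟩ := hg
  obtain ⟨hw, hwi⟩ := laurentIntegers_add_inv_mem (ha 1 0) h0 h (mul_mem (ha 1 1) hy)
  have hV := laurentVar_ne_zero (F := F)
  generalize hz : g 1 j * (laurentVar F * g 0 j)⁻¹ = z at *
  generalize hv : a 1 0 + laurentVar F * (a 1 1 * z) = w at *
  have e1 : g 1 j = z * laurentVar F * g 0 j := by rw [← hz]; field_simp
  have e2 : (a * g) 1 j = g 0 j * w := by
    rw [Matrix.SpecialLinearGroup.coe_mul, Matrix.mul_apply, Fin.sum_univ_two, e1, ← hv]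
    ring
  have e3 : (a * g) 0 j = g 0 j * (a 0 0 + laurentVar F * (a 0 1 * z)) := by
    rw [Matrix.SpecialLinearGroup.coe_mul, Matrix.mul_apply, Fin.sum_univ_two, e1]
    ring
  have e4 : (laurentVar F * (a * g) 1 j)⁻¹ = (laurentVar F * g 0 j)⁻¹ * w⁻¹ := by
    rw [e2, ← mul_inv, mul_assoc]
  have e5 : ((a * g) 1 j)⁻¹ = laurentVar F * ((laurentVar F * g 0 j)⁻¹ * w⁻¹) := by
    rw [← e4]
    field_simp
  refine ⟨j, ?_, ?_, ?_, .inr ?_⟩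
  · rw [e2]; exact mul_ne_zero hne hw
  · rw [e2, e3]
    have : g 0 j * (a 0 0 + laurentVar F * (a 0 1 * z)) * (g 0 j * w)⁻¹ =
        (a 0 0 + laurentVar F * (a 0 1 * z)) * w⁻¹ := by
      field_simp
    rw [this]
    exact mul_mem (add_mem (ha 0 0) (mul_mem laurentVar_mem (mul_mem (ha 0 1) hy))) hwi
  · rw [e5]; exact mul_mem laurentVar_mem (mul_mem hu hwi)
  · rw [e4]; exact mul_mem hu hwi

lemma UpperExpanding.mul {a g : SL(2, LaurentSeries F)} (ha : a ∈ parahoricTwo F)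
    (ha' : a ∉ parahoricOne F) (hg : LowerExpanding g) : UpperExpanding (a * g) := by
  obtain ⟨h0, h⟩ := inv_mem_of_mem_parahoricTwo ha ha'
  obtain ⟨j, hne, hx, hi, -⟩ := hg
  obtain ⟨h00, h11, h01, c, hc, h10⟩ := ha
  obtain ⟨hw, hwi⟩ := laurentIntegers_add_inv_mem h01 h0 h (mul_mem h00 hx)
  have hV := laurentVar_ne_zero (F := F)
  generalize hz : g 0 j * (g 1 j)⁻¹ = z at *
  generalize hv : laurentVar F * a 0 1 + laurentVar F * (a 0 0 * z) = w at *
  have e1 : g 0 j = z * g 1 j := by rw [← hz]; field_simp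
  have e2 : laurentVar F * (a * g) 0 j = g 1 j * w := by
    rw [Matrix.SpecialLinearGroup.coe_mul, Matrix.mul_apply, Fin.sum_univ_two, e1, ← hv]
    ring
  have e3 : (a * g) 1 j = g 1 j * (laurentVar F * (c * z) + a 1 1) := by
    rw [Matrix.SpecialLinearGroup.coe_mul, Matrix.mul_apply, Fin.sum_univ_two, e1, h10]
    ring
  refine ⟨j, ?_, ?_, ?_⟩
  · exact right_ne_zero_of_mul (e2 ▸ mul_ne_zero hne hw)
  · rw [e2, e3]
    have : g 1 j * (laurentVar F * (c * z) + a 1 1) * (g 1 j * w)⁻¹ =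
        (laurentVar F * (c * z) + a 1 1) * w⁻¹ := by
      field_simp
    rw [this]
    exact mul_mem (add_mem (mul_mem laurentVar_mem (mul_mem hc hx)) h11) hwi
  · rw [e2, mul_inv]; exact mul_mem hi hwi

lemma IsEdgeTransitivePair.expanding {A₁ A₂ : Subgroup SL(2, LaurentSeries F)}
    (h : IsEdgeTransitivePair A₁ A₂) {X Y : Subgroup SL(2, LaurentSeries F)}
    {g : SL(2, LaurentSeries F)} (hg : IsAlternating X Y g) :
    (X = A₁ → Y = A₂ → LowerExpanding g) ∧ (X = A₂ → Y = A₁ → UpperExpanding g) := by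
  induction hg with
  | @of X Y a hX hY =>
    constructor <;> rintro rfl rfl
    · exact .of_mem (h.mem_one a hX) (mt (h.inter_one a hX) hY)
    · exact .of_mem (h.mem_two a hX) (mt (h.inter_two a hX) hY)
  | @mul X Y a g hX hY _ ih =>
    constructor <;> rintro rfl rfl
    · exact .mul (h.mem_one a hX) (mt (h.inter_one a hX) hY) (ih.2 rfl rfl)
    · exact .mul (h.mem_two a hX) (mt (h.inter_two a hX) hY) (ih.1 rfl rfl)

/-- The group generated by an edge-transitive pair meets the Iwahori subgroup in the
intersection of the pair. -/
lemma IsEdgeTransitivePair.sup_inter_iwahori {A₁ A₂ : Subgroup SL(2, LaurentSeries F)}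
    (h : IsEdgeTransitivePair A₁ A₂) {g : SL(2, LaurentSeries F)} (hg : g ∈ A₁ ⊔ A₂)
    (hB : g ∈ iwahori F) : g ∈ A₁ ⊓ A₂ := by
  rcases mem_inf_or_isAlternating hg with hg | hg | hg
  · exact hg
  · exact absurd hB ((h.expanding hg).1 rfl rfl).notMem_iwahori
  · exact absurd hB ((h.expanding hg).2 rfl rfl).notMem_iwahori

/-- The condition that `g` is congruent to the identity modulo `u ^ n`. -/
def CongruentOne (n : ℕ) (g : SL(2, LaurentSeries F)) : Prop :=
  ∃ M : Matrix (Fin 2) (Fin 2) (LaurentSeries F), (∀ i j, M i j ∈ laurentIntegers F) ∧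
    (g : Matrix (Fin 2) (Fin 2) (LaurentSeries F)) = 1 + laurentVar F ^ n • M

lemma laurentIntegers_matrix_mul {M N : Matrix (Fin 2) (Fin 2) (LaurentSeries F)}
    (hM : ∀ i j, M i j ∈ laurentIntegers F) (hN : ∀ i j, N i j ∈ laurentIntegers F) (i j : Fin 2) :
    (M * N) i j ∈ laurentIntegers F := by
  rw [Matrix.mul_apply]
  exact sum_mem fun k _ ↦ mul_mem (hM i k) (hN k j)

lemma laurentIntegers_matrix_pow {M : Matrix (Fin 2) (Fin 2) (LaurentSeries F)}
    (hM : ∀ i j, M i j ∈ laurentIntegers F) (n : ℕ) (i j : Fin 2) :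
    (M ^ n) i j ∈ laurentIntegers F := by
  induction n generalizing i j with
  | zero =>
    rw [pow_zero, Matrix.one_apply]
    split_ifs
    exacts [one_mem _, zero_mem _]
  | succ n ih =>
    rw [pow_succ]
    exact laurentIntegers_matrix_mul ih hM i j

lemma CongruentOne.conj {n : ℕ} {g b : SL(2, LaurentSeries F)} (hg : CongruentOne n g)
    (hb : b ∈ parahoricOne F) : CongruentOne n (b * g * b⁻¹) := by
  obtain ⟨M, hM, hgM⟩ := hg
  refine ⟨b.1 * M * (b⁻¹).1, laurentIntegers_matrix_mul (laurentIntegers_matrix_mul hb hM)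
    (parahoricOne_inv_mem hb), ?_⟩
  have : b.1 * (b⁻¹).1 = 1 := by rw [← Matrix.SpecialLinearGroup.coe_mul, mul_inv_cancel]; rfl
  rw [Matrix.SpecialLinearGroup.coe_mul, Matrix.SpecialLinearGroup.coe_mul, hgM, Matrix.mul_add,
    Matrix.add_mul, Matrix.mul_one, this, Matrix.mul_smul, Matrix.smul_mul]

lemma CongruentOne.mono {m n : ℕ} (hmn : m ≤ n) {g : SL(2, LaurentSeries F)}
    (hg : CongruentOne n g) : CongruentOne m g := by
  obtain ⟨M, hM, hgM⟩ := hg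
  refine ⟨laurentVar F ^ (n - m) • M,
    fun i j ↦ mul_mem (pow_mem laurentVar_mem _) (hM i j), ?_⟩
  rw [hgM, smul_smul, ← pow_add, Nat.add_sub_cancel' hmn]

/-- A sequence in a finite subgroup tending to the identity attains the identity. -/
lemma exists_eq_one_of_congruentOne {A : Subgroup SL(2, LaurentSeries F)} [Finite A]
    {f : ℕ → SL(2, LaurentSeries F)} (hf : ∀ n, f n ∈ A) (h : ∀ n, CongruentOne n (f n)) :
    ∃ n, f n = 1 := by
  obtain ⟨y, hy⟩ := Finite.exists_infinite_fiber fun n ↦ (⟨f n, hf n⟩ : A)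
  rw [Set.infinite_coe_iff] at hy
  obtain ⟨n₀, hn₀⟩ := hy.nonempty
  refine ⟨n₀, Subtype.ext ?_⟩
  ext1 i j
  refine sub_eq_zero.1 (eq_zero_of_laurentVar_pow_dvd hy fun n hn ↦ ?_)
  obtain ⟨M, hM, hgM⟩ := h n
  have : f n₀ = f n := congrArg Subtype.val (hn₀.trans hn.symm)
  refine ⟨M i j, hM i j, ?_⟩
  rw [this, hgM]
  simp

lemma exists_primitive_fixed_vector {x : SL(2, LaurentSeries F)} (hdet : (x.1 - 1).det = 0) :
    ∃ c ∈ laurentIntegers F, x.1 *ᵥ ![1, c] = ![1, c] ∨ x.1 *ᵥ ![c, 1] = ![c, 1] := by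
  obtain ⟨v, hv0, hv⟩ := Matrix.exists_mulVec_eq_zero_iff.2 hdet
  rw [Matrix.sub_mulVec, Matrix.one_mulVec, sub_eq_zero] at hv
  have key : ∀ c : LaurentSeries F, x.1 *ᵥ (c • v) = c • v := fun c ↦ by
    rw [Matrix.mulVec_smul, hv]
  rcases eq_or_ne (v 0) 0 with h0 | h0
  · have h1 : v 1 ≠ 0 := fun h1 ↦ hv0 (by ext1 i; fin_cases i <;> assumption)
    refine ⟨0, zero_mem _, .inr ?_⟩
    have e : (v 1)⁻¹ • v = ![0, 1] := by
      ext1 i; fin_cases i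
      · simp [h0]
      · simp [h1]
    exact e ▸ key _
  · rcases ValuationRing.isInteger_or_isInteger (PowerSeries F) (v 1 / v 0) with ⟨c, hc⟩ | ⟨c, hc⟩
    · refine ⟨v 1 / v 0, ⟨c, hc⟩, .inl ?_⟩
      have e : (v 0)⁻¹ • v = ![1, v 1 / v 0] := by
        ext1 i; fin_cases i
        · simp [h0]
        · simp [div_eq_inv_mul]
      exact e ▸ key _
    · rcases eq_or_ne (v 1) 0 with h1 | h1
      · refine ⟨0, zero_mem _, .inl ?_⟩
        have e : (v 0)⁻¹ • v = ![1, 0] := by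
          ext1 i; fin_cases i
          · simp [h0]
          · simp [h1]
        exact e ▸ key _
      refine ⟨v 0 / v 1, ⟨c, by rw [← inv_div]; exact hc⟩, .inr ?_⟩
      have e : (v 1)⁻¹ • v = ![v 0 / v 1, 1] := by
        ext1 i; fin_cases i
        · simp [div_eq_inv_mul]
        · simp [h1]
      exact e ▸ key _

lemma exists_conj_unipotent {x : SL(2, LaurentSeries F)} (hx : x ∈ parahoricOne F)
    (hdet : (x.1 - 1).det = 0) :
    ∃ h ∈ parahoricOne F, ∃ t ∈ laurentIntegers F, (h⁻¹ * x * h).1 = !![1, t; 0, 1] := by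
  obtain ⟨h, hh, hxh⟩ : ∃ h ∈ parahoricOne F, x.1 *ᵥ (h.1 *ᵥ ![1, 0]) = h.1 *ᵥ ![1, 0] := by
    obtain ⟨c, hc, hv | hv⟩ := exists_primitive_fixed_vector hdet
    · refine ⟨⟨!![1, 0; c, 1], by simp [Matrix.det_fin_two_of]⟩, fun i j ↦ ?_, ?_⟩
      · fin_cases i <;> fin_cases j
        exacts [one_mem _, zero_mem _, hc, one_mem _]
      · have : !![1, 0; c, 1] *ᵥ ![1, 0] = ![1, c] := by
          ext1 i; fin_cases i <;> simp
        change x.1 *ᵥ (!![1, 0; c, 1] *ᵥ ![1, 0]) = !![1, 0; c, 1] *ᵥ ![1, 0]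
        rwa [this]
    · refine ⟨⟨!![c, -1; 1, 0], by simp [Matrix.det_fin_two_of]⟩, fun i j ↦ ?_, ?_⟩
      · fin_cases i <;> fin_cases j
        exacts [hc, neg_mem (one_mem _), one_mem _, zero_mem _]
      · have : !![c, -1; 1, 0] *ᵥ ![1, 0] = ![c, 1] := by
          ext1 i; fin_cases i <;> simp
        change x.1 *ᵥ (!![c, -1; 1, 0] *ᵥ ![1, 0]) = !![c, -1; 1, 0] *ᵥ ![1, 0]
        rwa [this]
  have hP : h⁻¹ * x * h ∈ parahoricOne F :=
    parahoricOne_mul_mem (parahoricOne_mul_mem (parahoricOne_inv_mem hh) hx) hh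
  have hv : (h⁻¹ * x * h).1 *ᵥ ![1, 0] = ![1, 0] := by
    rw [Matrix.SpecialLinearGroup.coe_mul, Matrix.SpecialLinearGroup.coe_mul,
      ← Matrix.mulVec_mulVec, ← Matrix.mulVec_mulVec, hxh, Matrix.mulVec_mulVec,
      ← Matrix.SpecialLinearGroup.coe_mul, inv_mul_cancel, Matrix.SpecialLinearGroup.coe_one,
      Matrix.one_mulVec]
  generalize hy : h⁻¹ * x * h = y at *
  refine ⟨h, hh, y 0 1, hP 0 1, ?_⟩
  rw [hy]
  have h0 : y.1 0 0 = 1 := by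
    have := congrFun hv 0
    simpa [Matrix.mulVec, dotProduct, Fin.sum_univ_two] using this
  have h1 : y.1 1 0 = 0 := by
    have := congrFun hv 1
    simpa [Matrix.mulVec, dotProduct, Fin.sum_univ_two] using this
  have h2 : y.1 1 1 = 1 := by
    have := y.2
    rw [Matrix.det_fin_two, h0, h1] at this
    simpa using this
  ext1 i j
  fin_cases i <;> fin_cases j
  exacts [h0, rfl, h1, h2]

/-- The translation `diag(u⁻¹, u)`. -/
noncomputable def laurentTranslation (F : Type*) [Field F] : SL(2, LaurentSeries F) :=
  ⟨!![(laurentVar F)⁻¹, 0; 0, laurentVar F], by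
    simp [Matrix.det_fin_two_of, laurentVar_ne_zero]⟩

lemma laurentTranslation_pow (n : ℕ) : (laurentTranslation F ^ n).1 =
    !![(laurentVar F)⁻¹ ^ n, 0; 0, laurentVar F ^ n] := by
  induction n with
  | zero => rw [pow_zero]; simp [Matrix.one_fin_two]
  | succ n ih =>
    rw [pow_succ, Matrix.SpecialLinearGroup.coe_mul, ih]
    change _ * !![(laurentVar F)⁻¹, 0; 0, laurentVar F] = _
    rw [Matrix.mul_fin_two]
    simp [pow_succ]

lemma laurentTranslation_eq_mul : ∃ a ∈ parahoricTwo F, ∃ b ∈ parahoricOne F,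
    laurentTranslation F = a * b := by
  have hV := laurentVar_ne_zero (F := F)
  refine ⟨⟨!![0, (laurentVar F)⁻¹; -laurentVar F, 0], by simp [Matrix.det_fin_two_of, hV]⟩,
    ⟨zero_mem _, zero_mem _, ?_, -1, neg_mem (one_mem _), ?_⟩,
    ⟨!![0, -1; 1, 0], by simp [Matrix.det_fin_two_of]⟩, ?_, ?_⟩
  · change laurentVar F * (laurentVar F)⁻¹ ∈ _
    rw [mul_inv_cancel₀ hV]
    exact one_mem _
  · change -laurentVar F = _
    ring
  · intro i j
    fin_cases i <;> fin_cases j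
    exacts [zero_mem _, neg_mem (one_mem _), one_mem _, zero_mem _]
  · refine Subtype.ext ?_
    change _ = !![0, (laurentVar F)⁻¹; -laurentVar F, 0] * !![0, -1; 1, 0]
    rw [Matrix.mul_fin_two]
    simp [laurentTranslation]

namespace IsEdgeTransitivePair

variable {A₁ A₂ : Subgroup SL(2, LaurentSeries F)}

lemma exists_eq_mul_laurentTranslation_pow (h : IsEdgeTransitivePair A₁ A₂)
    {x : SL(2, LaurentSeries F)} (hx : x ∈ parahoricOne F) (n : ℕ) :
    ∃ γ ∈ A₁ ⊔ A₂, ∃ b ∈ iwahori F, x * laurentTranslation F ^ n = γ * b := by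
  have one : ∀ y g : SL(2, LaurentSeries F), g ∈ parahoricOne F →
      (∃ γ ∈ A₁ ⊔ A₂, ∃ b ∈ iwahori F, y = γ * b) →
      ∃ γ ∈ A₁ ⊔ A₂, ∃ b ∈ iwahori F, y * g = γ * b := by
    rintro _ g hg ⟨γ, hγ, b, hb, rfl⟩
    obtain ⟨a, ha, b', hb', e⟩ := h.cover_one _ (parahoricOne_mul_mem hb.1 hg)
    exact ⟨γ * a, mul_mem hγ (le_sup_left (a := A₁) ha), b', hb',
      by rw [mul_assoc, e, mul_assoc]⟩
  have two : ∀ y g : SL(2, LaurentSeries F), g ∈ parahoricTwo F →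
      (∃ γ ∈ A₁ ⊔ A₂, ∃ b ∈ iwahori F, y = γ * b) →
      ∃ γ ∈ A₁ ⊔ A₂, ∃ b ∈ iwahori F, y * g = γ * b := by
    rintro _ g hg ⟨γ, hγ, b, hb, rfl⟩
    obtain ⟨a, ha, b', hb', e⟩ := h.cover_two _ (parahoricTwo_mul_mem hb.2 hg)
    exact ⟨γ * a, mul_mem hγ (le_sup_right (a := A₁) ha), b', hb',
      by rw [mul_assoc, e, mul_assoc]⟩
  induction n with
  | zero =>
    obtain ⟨a, ha, b, hb, e⟩ := h.cover_one _ hx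
    exact ⟨a, le_sup_left (a := A₁) ha, b, hb, by rw [pow_zero, mul_one, e]⟩
  | succ n ih =>
    obtain ⟨w, hw, w', hw', e⟩ := laurentTranslation_eq_mul (F := F)
    rw [pow_succ]
    nth_rw 2 [e]
    rw [← mul_assoc, ← mul_assoc]
    exact one _ _ hw' (two _ _ hw ih)

/-- A member of an edge-transitive pair of finite groups contains no nontrivial unipotents. -/
lemma eq_one_of_det_sub_one (h : IsEdgeTransitivePair A₁ A₂) [Finite A₁]
    {x : SL(2, LaurentSeries F)} (hx : x ∈ A₁) (hdet : (x.1 - 1).det = 0) : x = 1 := by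
  obtain ⟨g, hg, t, ht, e⟩ := exists_conj_unipotent (h.mem_one x hx) hdet
  have hV := laurentVar_ne_zero (F := F)
  choose γ hγ b hb hγb using h.exists_eq_mul_laurentTranslation_pow hg
  have conj (n : ℕ) : (γ n)⁻¹ * x * γ n = b n *
      ((laurentTranslation F ^ n)⁻¹ * (g⁻¹ * x * g) * laurentTranslation F ^ n) * (b n)⁻¹ := by
    have : γ n = g * laurentTranslation F ^ n * (b n)⁻¹ := by rw [hγb, mul_inv_cancel_right]
    rw [this]
    group
  have e' (n : ℕ) :
      ((laurentTranslation F ^ n)⁻¹ * (g⁻¹ * x * g) * laurentTranslation F ^ n).1 =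
        !![1, laurentVar F ^ n * (laurentVar F ^ n * t); 0, 1] := by
    rw [Matrix.SpecialLinearGroup.coe_mul, Matrix.SpecialLinearGroup.coe_mul, e,
      Matrix.SpecialLinearGroup.coe_inv, laurentTranslation_pow, Matrix.adjugate_fin_two_of,
      Matrix.mul_fin_two, Matrix.mul_fin_two]
    ext1 i j
    fin_cases i <;> fin_cases j <;> simp [hV]
    ring
  have hmem (n : ℕ) : (γ n)⁻¹ * x * γ n ∈ A₁ := by
    refine (h.sup_inter_iwahori (mul_mem (mul_mem (inv_mem (hγ n))
      (le_sup_left (a := A₁) hx)) (hγ n)) ?_).1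
    have hn : laurentVar F ^ n * (laurentVar F ^ n * t) ∈ laurentIntegers F :=
      mul_mem (pow_mem laurentVar_mem _) (mul_mem (pow_mem laurentVar_mem _) ht)
    rw [conj]
    constructor
    · refine parahoricOne_mul_mem (parahoricOne_mul_mem (hb n).1 ?_)
        (parahoricOne_inv_mem (hb n).1)
      intro i j
      rw [e']
      fin_cases i <;> fin_cases j
      exacts [one_mem _, hn, zero_mem _, one_mem _]
    · refine parahoricTwo_mul_mem (parahoricTwo_mul_mem (hb n).2 ?_)
        (parahoricTwo_inv_mem (hb n).2)
      rw [parahoricTwo, Set.mem_ofPred_eq, e']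
      exact ⟨one_mem _, one_mem _, mul_mem laurentVar_mem hn, 0, zero_mem _, by simp⟩
  have hcong (n : ℕ) : CongruentOne n ((γ n)⁻¹ * x * γ n) := by
    rw [conj]
    refine CongruentOne.conj ⟨!![0, laurentVar F ^ n * t; 0, 0], fun i j ↦ ?_, ?_⟩ (hb n).1
    · fin_cases i <;> fin_cases j
      exacts [zero_mem _, mul_mem (pow_mem laurentVar_mem _) ht, zero_mem _, zero_mem _]
    · rw [e', Matrix.one_fin_two]
      ext1 i j
      fin_cases i <;> fin_cases j <;> simp
  obtain ⟨n, hn⟩ := exists_eq_one_of_congruentOne hmem hcong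
  have : x = γ n * ((γ n)⁻¹ * x * γ n) * (γ n)⁻¹ := by group
  rw [this, hn, mul_one, mul_inv_cancel]

end IsEdgeTransitivePair

lemma laurentSeries_charP (p : ℕ) [CharP F p] : CharP (LaurentSeries F) p :=
  charP_of_injective_ringHom (HahnSeries.C_injective (Γ := ℤ)) p

lemma matrix_det_eq_zero_of_pow {K : Type*} [Field K] {M : Matrix (Fin 2) (Fin 2) K} {n : ℕ}
    (h : M ^ n = 0) : M.det = 0 := by
  refine eq_zero_of_pow_eq_zero (n := n) ?_
  rw [← Matrix.det_pow, h]
  simp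

lemma CongruentOne.pow_char_pow (p : ℕ) [Fact p.Prime]
    [CharP F p] {x : SL(2, LaurentSeries F)} (hx : CongruentOne 1 x) (n : ℕ) :
    CongruentOne n (x ^ p ^ n) := by
  have := laurentSeries_charP (F := F) p
  refine CongruentOne.mono (Nat.lt_pow_self (Fact.out : p.Prime).one_lt).le ?_
  obtain ⟨M, hM, e⟩ := hx
  refine ⟨M ^ p ^ n, laurentIntegers_matrix_pow hM _, ?_⟩
  rw [Matrix.SpecialLinearGroup.coe_pow, e,
    add_pow_char_pow_of_commute (p := p) (h := Commute.one_left _), one_pow, smul_pow, pow_one]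

namespace IsEdgeTransitivePair

variable {A₁ A₂ : Subgroup SL(2, LaurentSeries F)}

lemma eq_one_of_pow_eq_one (h : IsEdgeTransitivePair A₁ A₂) [Finite A₁] (p : ℕ) [Fact p.Prime]
    [CharP F p] {x : SL(2, LaurentSeries F)} (hx : x ∈ A₁) (n : ℕ) (hxn : x ^ p ^ n = 1) :
    x = 1 := by
  have := laurentSeries_charP (F := F) p
  refine h.eq_one_of_det_sub_one hx (matrix_det_eq_zero_of_pow (n := p ^ n) ?_)
  rw [sub_pow_char_pow_of_commute (p := p) (h := Commute.one_right _), one_pow,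
    ← Matrix.SpecialLinearGroup.coe_pow, hxn, Matrix.SpecialLinearGroup.coe_one, sub_self]

/-- Reduction modulo `u` embeds a member of an edge-transitive pair of finite groups in
`SL₂(F)`. -/
lemma exists_reduction (h : IsEdgeTransitivePair A₁ A₂) [Finite A₁] (p : ℕ) [Fact p.Prime]
    [CharP F p] : ∃ ψ : A₁ →* SL(2, F), Function.Injective ψ ∧
      (∀ x : A₁, x.1 ∈ parahoricTwo F → ψ x 1 0 = 0) ∧
      ∀ z : F, ∃ x : A₁, ψ x 1 0 ≠ 0 ∧ ψ x 0 0 = z * ψ x 1 0 := by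
  let ι := Matrix.SpecialLinearGroup.map (n := Fin 2) (HahnSeries.ofPowerSeries ℤ F)
  have hι : Function.Injective ι := fun f g hfg ↦ by
    ext1 i j
    exact HahnSeries.ofPowerSeries_injective (congrArg (fun x ↦ x.1 i j) hfg)
  have hle : A₁ ≤ ι.range := fun x hx ↦ by
    have := h.mem_one x hx
    rwa [parahoricOne_eq_range] at this
  let ψ := (Matrix.SpecialLinearGroup.map (n := Fin 2) (PowerSeries.constantCoeff (R := F))).comp
    ((MonoidHom.ofInjective hι).symm.toMonoidHom.comp (Subgroup.inclusion hle))
  have hψ : ∀ x : A₁, ∃ f : SL(2, PowerSeries F),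
      (∀ i j, x.1 i j = HahnSeries.ofPowerSeries ℤ F (f i j)) ∧
      ∀ i j, ψ x i j = PowerSeries.constantCoeff (f i j) := fun x ↦ by
    refine ⟨(MonoidHom.ofInjective hι).symm (Subgroup.inclusion hle x), fun i j ↦ ?_,
      fun i j ↦ rfl⟩
    have := congrArg Subtype.val
      ((MonoidHom.ofInjective hι).apply_symm_apply (Subgroup.inclusion hle x))
    exact (congrArg (fun y ↦ y.1 i j) this).symm
  have hdvd {f : PowerSeries F} {y : LaurentSeries F} (hy : y ∈ laurentIntegers F)
      (e : HahnSeries.ofPowerSeries ℤ F f = laurentVar F * y) :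
      PowerSeries.constantCoeff f = 0 := by
    obtain ⟨g, rfl⟩ := hy
    rw [laurentVar, ← map_mul] at e
    rw [HahnSeries.ofPowerSeries_injective e]
    simp
  refine ⟨ψ, (injective_iff_map_eq_one ψ).2 fun x hx ↦ ?_, fun x hx ↦ ?_, fun z ↦ ?_⟩
  · have hc : CongruentOne 1 x.1 := by
      obtain ⟨f, hf, hf'⟩ := hψ x
      have : ∀ i j, ∃ y, f i j = (1 : Matrix (Fin 2) (Fin 2) (PowerSeries F)) i j +
          PowerSeries.X * y := fun i j ↦ by
        have h0 : PowerSeries.constantCoeff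
            (f i j - (1 : Matrix (Fin 2) (Fin 2) (PowerSeries F)) i j) = 0 := by
          rw [map_sub, ← hf', hx, Matrix.SpecialLinearGroup.coe_one, Matrix.one_apply,
            Matrix.one_apply]
          split_ifs <;> simp
        obtain ⟨y, hy⟩ := PowerSeries.X_dvd_iff.2 h0
        exact ⟨y, by rw [← hy]; ring⟩
      choose y hy using this
      refine ⟨Matrix.of fun i j ↦ HahnSeries.ofPowerSeries ℤ F (y i j), fun i j ↦ ⟨_, rfl⟩, ?_⟩
      ext1 i j
      rw [hf, hy, map_add, map_mul, pow_one, Matrix.add_apply, Matrix.smul_apply,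
        Matrix.one_apply, Matrix.one_apply]
      split_ifs <;> simp [laurentVar]
    obtain ⟨n, hn⟩ := exists_eq_one_of_congruentOne (A := A₁) (f := fun n ↦ x.1 ^ p ^ n)
      (fun n ↦ pow_mem x.2 _) (hc.pow_char_pow p)
    exact Subtype.ext (h.eq_one_of_pow_eq_one p x.2 n hn)
  · obtain ⟨f, hf, hf'⟩ := hψ x
    obtain ⟨-, -, -, y, hy, e⟩ := hx
    rw [hf']
    exact hdvd hy ((hf 1 0).symm.trans e)
  · have hP : ι (⟨!![PowerSeries.C z, -1; 1, 0], by simp [Matrix.det_fin_two_of]⟩) ∈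
        parahoricOne F := fun i j ↦ ⟨_, rfl⟩
    obtain ⟨x, hx, b, hb, e⟩ := h.cover_one _ hP
    obtain ⟨f, hf, hf'⟩ := hψ ⟨x, hx⟩
    obtain ⟨b₀, hb₀⟩ : b ∈ ι.range := by
      have := hb.1
      rwa [parahoricOne_eq_range] at this
    have hb10 : PowerSeries.constantCoeff (b₀ 1 0) = 0 := by
      obtain ⟨-, -, -, y, hy, e⟩ := hb.2
      rw [← hb₀] at e
      exact hdvd hy e
    have e' : (⟨!![PowerSeries.C z, -1; 1, 0], by simp [Matrix.det_fin_two_of]⟩ :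
        SL(2, PowerSeries F)) = f * b₀ := by
      apply hι
      rw [e, map_mul, hb₀]
      congr 1
      ext1 i j
      exact hf i j
    have key (i : Fin 2) : PowerSeries.constantCoeff (!![PowerSeries.C z, -1; 1, 0] i 0) =
        ψ ⟨x, hx⟩ i 0 * PowerSeries.constantCoeff (b₀ 0 0) := by
      have : !![PowerSeries.C z, -1; 1, 0] i 0 = (f.1 * b₀.1) i 0 :=
        congrArg (fun y ↦ y.1 i 0) e'
      rw [this, Matrix.mul_apply, Fin.sum_univ_two, map_add, map_mul, map_mul, hb10, mul_zero,
        add_zero, hf']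
    have k0 : z = ψ ⟨x, hx⟩ 0 0 * PowerSeries.constantCoeff (b₀ 0 0) := by simpa using key 0
    have k1 : 1 = ψ ⟨x, hx⟩ 1 0 * PowerSeries.constantCoeff (b₀ 0 0) := by simpa using key 1
    refine ⟨⟨x, hx⟩, left_ne_zero_of_mul (k1 ▸ one_ne_zero), ?_⟩
    rw [k0, mul_assoc, mul_comm _ (ψ ⟨x, hx⟩ 1 0), ← k1, mul_one]

end IsEdgeTransitivePair

end EdgeTransitive

/-! ### Groups whose nontrivial elements have two fixed points -/

section TwoFixedPoints

/-- The spherical solutions of `1 / a + 1 / b + 1 / c = 1 + 2 / g`. -/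
lemma spherical_triple {a b c g : ℕ} (ha : 2 ≤ a) (hab : a ≤ b) (hbc : b ≤ c)
    (h : g * (b * c + a * c + a * b) = (g + 2) * (a * b * c)) :
    2 * c = g ∨ g = 12 ∨ g = 24 ∨ g = 60 := by
  have hc : 0 < c := by omega
  have hb : 0 < b := by omega
  have ha' : a = 2 := by
    by_contra hne
    have h3 : 3 ≤ a := by omega
    have h1 : 3 * (b * c) ≤ a * b * c := by
      rw [mul_assoc]; exact Nat.mul_le_mul_right _ h3
    have h2 : 3 * (a * c) ≤ a * b * c := by
      calc 3 * (a * c) ≤ b * (a * c) := Nat.mul_le_mul_right _ (h3.trans hab)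
        _ = a * b * c := by ring
    have h4 : 3 * (a * b) ≤ a * b * c := by
      calc 3 * (a * b) ≤ c * (a * b) := Nat.mul_le_mul_right _ (by omega)
        _ = a * b * c := by ring
    have h5 : 0 < a * b * c := by positivity
    have h6 := Nat.mul_le_mul_left g (by omega : b * c + a * c + a * b ≤ a * b * c)
    rw [h, add_mul] at h6
    omega
  subst ha'
  have hb4 : b < 4 := by
    by_contra hb4
    have h1 : 4 * c ≤ b * c := Nat.mul_le_mul_right _ (by omega)
    have h2 : 4 * b ≤ b * c := by rw [mul_comm b]; exact Nat.mul_le_mul_right _ (by omega)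
    have h3 : 0 < 2 * b * c := by positivity
    have h4 := Nat.mul_le_mul_left g
      (by rw [mul_assoc]; omega : b * c + 2 * c + 2 * b ≤ 2 * b * c)
    rw [h, add_mul] at h4
    omega
  interval_cases b
  · left; nlinarith
  · right
    have hc6 : c < 6 := by
      by_contra hc6
      have := Nat.mul_le_mul_left g (by omega : 6 ≤ c)
      nlinarith
    interval_cases c <;> omega

lemma spherical_triple_of_two_mul_le {a b c g : ℕ} (ha : 2 ≤ a) (hb : 2 ≤ b) (hc : 2 ≤ c)
    (h : g * (b * c + a * c + a * b) = (g + 2) * (a * b * c)) :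
    2 * a = g ∨ 2 * b = g ∨ 2 * c = g ∨ g = 12 ∨ g = 24 ∨ g = 60 := by
  rcases le_total a b with hab | hab <;> rcases le_total b c with hbc | hbc <;>
    rcases le_total a c with hac | hac
  · have := spherical_triple ha hab hbc h; tauto
  · have := spherical_triple ha hab hbc h; tauto
  · have := spherical_triple ha hac hbc (by linarith); tauto
  · have := spherical_triple hc hac hab (by linarith); tauto
  · have := spherical_triple hb hab hac (by linarith); tauto
  · have := spherical_triple hb hbc hac (by linarith); tauto
  · have := spherical_triple hc hbc hab (by linarith); tauto
  · have := spherical_triple hc hbc hab (by linarith); tauto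

lemma spherical_sum {ι : Type*} {J : Finset ι} {n : ι → ℕ} {g : ℕ} (hg : 2 ≤ g)
    (hn : ∀ i ∈ J, 2 ≤ n i) (hle : ∀ i ∈ J, 2 * n i ≤ g)
    (hsum : ∑ i ∈ J, (1 - 1 / (n i : ℚ)) = 2 - 2 / g) :
    (∃ i ∈ J, 2 * n i = g) ∨ g = 12 ∨ g = 24 ∨ g = 60 := by
  classical
  have hg0 : (0 : ℚ) < g := by exact_mod_cast (by omega : 0 < g)
  have hg1 : (2 : ℚ) / g ≤ 1 := by rw [div_le_one hg0]; exact_mod_cast hg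
  have hg2 : (0 : ℚ) < 2 / g := by positivity
  have hlow : (J.card : ℚ) * (1 / 2) ≤ 2 - 2 / g := by
    rw [← hsum, ← nsmul_eq_mul]
    refine Finset.card_nsmul_le_sum _ _ _ fun i hi ↦ ?_
    have : (2 : ℚ) ≤ n i := by exact_mod_cast hn i hi
    have := one_div_le_one_div_of_le (by norm_num) this
    linarith
  have hup : (2 - 2 / g : ℚ) ≤ J.card * (1 - 2 / g) := by
    rw [← hsum, ← nsmul_eq_mul]
    refine Finset.sum_le_card_nsmul _ _ _ fun i hi ↦ ?_
    have h0 : (0 : ℚ) < n i := by exact_mod_cast (by have := hn i hi; omega : 0 < n i)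
    have h1 : (2 * n i : ℚ) ≤ g := by exact_mod_cast hle i hi
    have : (2 : ℚ) / g ≤ 1 / n i := by
      rw [div_le_div_iff₀ hg0 h0]
      linarith
    linarith
  have h3 : J.card = 3 := by
    have hlt : J.card < 4 := by
      by_contra! hge
      have : (4 : ℚ) ≤ J.card := by exact_mod_cast hge
      linarith
    have hgt : 2 < J.card := by
      by_contra! hle
      have : (J.card : ℚ) ≤ 2 := by exact_mod_cast hle
      have := mul_le_mul_of_nonneg_right this (by linarith : (0 : ℚ) ≤ 1 - 2 / g)
      linarith
    omega
  obtain ⟨x, y, z, hxy, hxz, hyz, rfl⟩ := Finset.card_eq_three.1 h3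
  have hx := hn x (by simp)
  have hy := hn y (by simp)
  have hz := hn z (by simp)
  have hx0 : (n x : ℚ) ≠ 0 := by positivity
  have hy0 : (n y : ℚ) ≠ 0 := by positivity
  have hz0 : (n z : ℚ) ≠ 0 := by positivity
  rw [Finset.sum_insert (by simp [hxy, hxz]), Finset.sum_insert (by simp [hyz]),
    Finset.sum_singleton] at hsum
  have key : g * (n y * n z + n x * n z + n x * n y) = (g + 2) * (n x * n y * n z) := by
    field_simp at hsum
    have : (g : ℚ) * (n y * n z + n x * n z + n x * n y) = (g + 2) * (n x * n y * n z) := by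
      linear_combination -hsum
    exact_mod_cast this
  rcases spherical_triple_of_two_mul_le hx hy hz key with h | h | h | h
  · exact .inl ⟨x, by simp, h⟩
  · exact .inl ⟨y, by simp, h⟩
  · exact .inl ⟨z, by simp, h⟩
  · exact .inr h

open MulAction in
/-- A finite group acting with a kernel of order two, all other elements fixing exactly two
points, has an orbit of length two or the order of a binary polyhedral group. -/
theorem exists_two_mul_card_stabilizer_eq {G Ω : Type*} [Group G] [MulAction G Ω] [Finite G]
    [Finite Ω] [Nonempty Ω] (Z : Subgroup G) (hZ : Nat.card Z = 2)
    (htriv : ∀ g ∈ Z, ∀ z : Ω, g • z = z)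
    (hfix : ∀ g ∉ Z, Nat.card (fixedBy Ω g) = 2)
    (hle : ∀ z : Ω, 2 * Nat.card (stabilizer G z) ≤ Nat.card G) :
    (∃ z : Ω, 2 * Nat.card (stabilizer G z) = Nat.card G) ∨
      Nat.card G = 24 ∨ Nat.card G = 48 ∨ Nat.card G = 120 := by
  classical
  have := Fintype.ofFinite G
  have := Fintype.ofFinite Ω
  have : Fintype (Quotient (orbitRel G Ω)) := Fintype.ofFinite _
  have hZle (z : Ω) : Z ≤ stabilizer G z := fun g hg ↦ htriv g hg z
  have hdvd (z : Ω) : 2 ∣ Nat.card (stabilizer G z) := hZ ▸ Subgroup.card_dvd_of_le (hZle z)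
  obtain ⟨g, hg⟩ : 2 ∣ Nat.card G := hZ ▸ Subgroup.card_subgroup_dvd_card Z
  choose n hn using hdvd
  have hpos (z : Ω) : 0 < n z := by
    have := Nat.card_pos (α := stabilizer G z)
    have := hn z
    omega
  have hle' (z : Ω) : 2 * n z ≤ g := by
    have := hle z
    have := hn z
    omega
  have hg2 : 2 ≤ g := by
    obtain ⟨z⟩ := ‹Nonempty Ω›
    have := hle' z
    have := hpos z
    omega
  have hg0 : (g : ℚ) ≠ 0 := by positivity
  have hcardZ : ((Finset.univ.filter (· ∈ Z)).card : ℚ) = 2 := by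
    rw [← Fintype.card_subtype, ← Nat.card_eq_fintype_card]
    exact_mod_cast hZ
  have hburn : (∑ x : G, (Nat.card (fixedBy Ω x) : ℚ)) =
      Fintype.card (Quotient (orbitRel G Ω)) * (2 * g) := by
    have := sum_card_fixedBy_eq_card_orbits_mul_card_group G Ω
    rw [← Nat.card_eq_fintype_card (α := G), hg] at this
    simp only [← Nat.card_eq_fintype_card (α := fixedBy Ω _)] at this
    exact_mod_cast this
  have hburn' : (∑ x : G, (Nat.card (fixedBy Ω x) : ℚ)) =
      2 * Fintype.card Ω + 2 * (2 * g - 2) := by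
    rw [← Finset.sum_filter_add_sum_filter_not _ (· ∈ Z)]
    congr 1
    · rw [Finset.sum_congr rfl (g := fun _ ↦ (Fintype.card Ω : ℚ)) fun x hx ↦ ?_,
        Finset.sum_const, nsmul_eq_mul, hcardZ]
      have : fixedBy Ω x = Set.univ :=
        Set.eq_univ_of_forall (htriv x (Finset.mem_filter.1 hx).2)
      rw [this, Nat.card_univ, Nat.card_eq_fintype_card]
    · rw [Finset.sum_congr rfl (g := fun _ ↦ (2 : ℚ)) fun x hx ↦ ?_,
        Finset.sum_const, nsmul_eq_mul, mul_comm]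
      · congr 1
        have := Finset.card_filter_add_card_filter_not (s := (Finset.univ : Finset G)) (· ∈ Z)
        rw [Finset.card_univ, ← Nat.card_eq_fintype_card, hg] at this
        have h' : (((Finset.univ.filter (· ∈ Z)).card : ℚ) +
          (Finset.univ.filter (· ∉ Z)).card) = 2 * g := by exact_mod_cast this
        linarith
      · exact_mod_cast hfix x (Finset.mem_filter.1 hx).2
  have hcard : (Fintype.card Ω : ℚ) = ∑ ω : Quotient (orbitRel G Ω), (g : ℚ) / n ω.out := by
    rw [card_eq_sum_card_group_div_card_stabilizer G Ω]
    push_cast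
    refine Finset.sum_congr rfl fun ω _ ↦ ?_
    rw [← Nat.card_eq_fintype_card, ← Nat.card_eq_fintype_card, hn, hg,
      Nat.mul_div_mul_left _ _ two_pos, Nat.cast_div]
    · have h1 := Subgroup.card_subgroup_dvd_card (stabilizer G ω.out)
      rw [hn, hg] at h1
      exact Nat.dvd_of_mul_dvd_mul_left two_pos h1
    · have := hpos ω.out
      positivity
  have hsum : ∑ ω : Quotient (orbitRel G Ω), (1 - 1 / (n ω.out : ℚ)) = 2 - 2 / g := by
    have h1 : ∑ ω : Quotient (orbitRel G Ω), (g : ℚ) / n ω.out =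
        g * ∑ ω : Quotient (orbitRel G Ω), 1 / (n ω.out : ℚ) := by
      rw [Finset.mul_sum]
      exact Finset.sum_congr rfl fun _ _ ↦ by ring
    rw [Finset.sum_sub_distrib, Finset.sum_const, Finset.card_univ, nsmul_eq_mul, mul_one]
    rw [h1] at hcard
    rw [hburn, hcard] at hburn'
    field_simp
    linear_combination hburn' / 2
  rcases spherical_sum (J := Finset.univ.filter fun ω : Quotient (orbitRel G Ω) ↦ 2 ≤ n ω.out)
    hg2 (fun ω hω ↦ (Finset.mem_filter.1 hω).2) (fun ω _ ↦ hle' ω.out) (by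
      rw [← hsum]
      refine Finset.sum_subset (Finset.filter_subset _ _) fun ω _ hω ↦ ?_
      have h1 : n ω.out = 1 := by
        have := hpos ω.out
        simp only [Finset.mem_filter, Finset.mem_univ, true_and] at hω
        omega
      rw [h1]
      norm_num) with ⟨ω, -, hω⟩ | h
  · exact .inl ⟨ω.out, by rw [hn, hg, hω]⟩
  · right; omega

end TwoFixedPoints

/-! ### Recognizing dihedral groups -/

/-- A group of order `2n` is dihedral if it has an element `t` of order `n` and all elements
outside the subgroup generated by `t` are involutions. -/
theorem nonempty_mulEquiv_dihedralGroup {D : Type*} [Group D] {n : ℕ} [NeZero n]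
    (hD : Nat.card D = 2 * n) {t : D} (ht : orderOf t = n)
    (hinv : ∀ y, y ∉ Subgroup.zpowers t → y * y = 1) : Nonempty (D ≃* DihedralGroup n) := by
  have hn : 0 < n := NeZero.pos n
  have : Finite D := Nat.finite_of_card_ne_zero (by omega)
  obtain ⟨x, hx⟩ : ∃ x, x ∉ Subgroup.zpowers t := by
    by_contra! h
    have := orderOf_eq_card_of_forall_mem_zpowers h
    omega
  have hxx := hinv x hx
  have hmem {y : D} (hy : y ∈ Subgroup.zpowers t) : x * y ∉ Subgroup.zpowers t :=
    fun h ↦ hx ((Subgroup.mul_mem_cancel_right _ hy).1 h)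
  let f : ZMod n →+ Additive D := ZMod.lift n ⟨zmultiplesHom _ (Additive.ofMul t), by
    simp [← ofMul_pow, ← ht, pow_orderOf_eq_one]⟩
  let e (i : ZMod n) : D := (f i).toMul
  have he_add (i j : ZMod n) : e (i + j) = e i * e j := by simp [e]
  have he_sub (i j : ZMod n) : e (j - i) = (e i)⁻¹ * e j := by
    rw [sub_eq_neg_add, he_add]; simp [e]
  have he_mem (i : ZMod n) : e i ∈ Subgroup.zpowers t := by
    obtain ⟨k, rfl⟩ := ZMod.intCast_surjective i
    exact ⟨k, by simp [e, f]⟩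
  have hconj (i : ZMod n) : e i * x = x * (e i)⁻¹ := by
    have h := hinv _ (hmem (he_mem i))
    rw [eq_mul_inv_iff_mul_eq, ← mul_right_inj x, hxx, ← h]
    simp only [mul_assoc]
  have he_comm (i j : ZMod n) : e i * e j = e j * e i := by
    rw [← he_add, add_comm, he_add]
  let φ : DihedralGroup n →* D :=
    { toFun := fun y ↦ match y with
        | .r i => e i
        | .sr i => x * e i
      map_one' := by
        change e 0 = 1
        simp [e]
      map_mul' := by
        rintro (i | i) (j | j)
        · exact he_add i j
        · change x * e (j - i) = e i * (x * e j)
          rw [he_sub, ← mul_assoc, ← mul_assoc, hconj]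
        · change x * e (i + j) = x * e i * e j
          rw [he_add, mul_assoc]
        · change e (j - i) = x * e i * (x * e j)
          rw [he_sub, mul_assoc, ← mul_assoc (e i), hconj, mul_assoc, ← mul_assoc x, hxx,
            one_mul] }
  have he_inj {i : ZMod n} (h : e i = 1) : i = 0 := by
    obtain ⟨k, rfl⟩ := ZMod.intCast_surjective i
    have : t ^ k = 1 := by simpa [e, f] using h
    rwa [← orderOf_dvd_iff_zpow_eq_one, ht, ← ZMod.intCast_zmod_eq_zero_iff_dvd] at this
  have hφ : Function.Injective φ := (injective_iff_map_eq_one φ).2 <| by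
    rintro (i | i) h
    · rw [he_inj h]
      rfl
    · exact absurd ((show x * e i = 1 from h) ▸ Subgroup.one_mem _) (hmem (he_mem i))
  have hcard : Nat.card (DihedralGroup n) = Nat.card D := by rw [DihedralGroup.nat_card, hD]
  exact ⟨(MulEquiv.ofBijective φ
    ((Nat.bijective_iff_injective_and_card φ).2 ⟨hφ, hcard⟩)).symm⟩

/-- A subgroup `A` is generalized dicyclic of order `2n`, with central element `z`, if it contains
an element `t` of order `n` such that all elements of `A` outside `⟨t⟩` are square roots of `z`. -/
structure IsGeneralizedDicyclic {G : Type*} [Group G] (z : G) (A : Subgroup G) (n : ℕ) : Prop where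
  mem : z ∈ A
  card : Nat.card A = 2 * n
  exists_orderOf : ∃ t ∈ A, orderOf t = n ∧ ∀ x ∈ A, x ∉ Subgroup.zpowers t → x * x = z

lemma IsGeneralizedDicyclic.of_range {G G' : Type*} [Group G] [Group G'] {A : Subgroup G} {z : G}
    {z' : G'} {n : ℕ} {φ : A →* G'} (hφ : Function.Injective φ) (hz : ∀ x, φ x = z' → x.1 = z)
    (h : IsGeneralizedDicyclic z' φ.range n) : IsGeneralizedDicyclic z A n := by
  obtain ⟨t, ⟨t, rfl⟩, ht, hdic⟩ := h.exists_orderOf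
  refine ⟨?_, ?_, t, t.2, ?_, fun x hx hxt ↦ ?_⟩
  · obtain ⟨x, hx⟩ := h.mem
    exact hz x hx ▸ x.2
  · rw [← h.card]
    exact Nat.card_congr (MonoidHom.ofInjective hφ).toEquiv
  · rwa [Subgroup.orderOf_coe, ← orderOf_injective φ hφ]
  · refine hz (⟨x, hx⟩ * ⟨x, hx⟩) ((map_mul φ _ _).trans (hdic _ ⟨_, rfl⟩ ?_))
    rintro ⟨k, hk⟩
    have : t ^ k = ⟨x, hx⟩ := hφ (by simpa using hk)
    exact hxt ⟨k, by simpa using congrArg Subtype.val this⟩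

/-- The quotient of a generalized dicyclic group by its central involution is dihedral. -/
theorem IsGeneralizedDicyclic.nonempty_map_center_mulEquiv {G : Type*} [Group G] {z : G}
    (hz : z ≠ 1) (hcenter : ∀ g, g ∈ Subgroup.center G ↔ g = 1 ∨ g = z) {A : Subgroup G} {m : ℕ}
    [NeZero m] (h : IsGeneralizedDicyclic z A (2 * m)) :
    Nonempty (A.map (QuotientGroup.mk' (Subgroup.center G)) ≃* DihedralGroup m) := by
  obtain ⟨t, htA, ht, hdic⟩ := h.exists_orderOf
  have hzA := h.mem
  have hA := h.card
  have hzz : z * z = 1 := by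
    have h := (hcenter z).2 (.inr rfl)
    exact ((hcenter _).1 (Subgroup.mul_mem _ h h)).resolve_right fun h ↦ hz (mul_eq_left.1 h)
  have hpow {n : ℕ} : t ^ n ∈ Subgroup.center G → m ∣ n := fun h ↦ by
    have h1 : t ^ (2 * n) = 1 := by
      rw [mul_comm, pow_mul, sq]
      rcases (hcenter _).1 h with h | h <;> simp [h, hzz]
    rw [← orderOf_dvd_iff_pow_eq_one, ht] at h1
    exact Nat.dvd_of_mul_dvd_mul_left two_pos h1
  have htm : t ^ m ∈ Subgroup.center G := by
    have hzt : z ∈ Subgroup.zpowers t := by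
      by_contra h
      exact hz (mul_eq_left.1 (hdic z hzA h))
    have : IsOfFinOrder t := orderOf_pos_iff.1 (by rw [ht]; have := NeZero.pos m; omega)
    obtain ⟨k, hk : t ^ k = z⟩ := this.mem_powers_iff_mem_zpowers.2 hzt
    obtain ⟨j, rfl⟩ := hpow ((hcenter _).2 (.inr hk))
    have h1 (i : ℕ) : t ^ (m * (i + i)) = 1 := by
      rw [show m * (i + i) = 2 * m * i by ring, pow_mul, ← ht, pow_orderOf_eq_one, one_pow]
    rcases Nat.even_or_odd j with ⟨i, rfl⟩ | ⟨i, rfl⟩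
    · exact absurd (hk.symm.trans (h1 i)) hz
    · rw [mul_add, two_mul, pow_add, h1, one_mul, mul_one] at hk
      exact (hcenter _).2 (.inr hk)
  have hker : Nat.card (A.map (QuotientGroup.mk' (Subgroup.center G))) = 2 * m := by
    have h1 : Subgroup.center G ≤ A := fun g hg ↦ by
      rcases (hcenter g).1 hg with rfl | rfl
      exacts [A.one_mem, hzA]
    have h2 := Subgroup.card_mul_index ((Subgroup.center G).subgroupOf A)
    have h3 : Nat.card (Subgroup.center G) = 2 := by
      rw [← Set.ncard_pair hz.symm, ← Nat.card_coe_set_eq]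
      exact congrArg (fun s : Set G ↦ Nat.card s) (Set.ext hcenter)
    rw [Nat.card_congr (Subgroup.subgroupOfEquivOfLe h1).toEquiv, h3, hA] at h2
    rw [← Subgroup.relIndex_ker, QuotientGroup.ker_mk', Subgroup.relIndex]
    omega
  refine nonempty_mulEquiv_dihedralGroup hker
    (t := ⟨QuotientGroup.mk' _ t, Subgroup.mem_map_of_mem _ htA⟩) ?_ ?_
  · rw [Subgroup.orderOf_mk]
    refine Nat.dvd_antisymm (orderOf_dvd_of_pow_eq_one ?_) (hpow ?_)
    · rw [← map_pow]
      exact (QuotientGroup.eq_one_iff _).2 htm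
    · rw [← QuotientGroup.eq_one_iff]
      exact pow_orderOf_eq_one (QuotientGroup.mk' (Subgroup.center G) t)
  · rintro ⟨_, x, hx, rfl⟩ hxt
    have hxx := hdic x hx fun ⟨k, hk⟩ ↦ hxt ⟨k, Subtype.ext (by simp [← hk])⟩
    refine Subtype.ext ?_
    change QuotientGroup.mk' _ x * QuotientGroup.mk' _ x = 1
    rw [← map_mul, hxx]
    exact (QuotientGroup.eq_one_iff _).2 ((hcenter z).2 (.inr rfl))

/-! ### The action of `SL₂(F)` on the projective line of an extension of `F` -/

section ProjectiveLine

lemma mem_range_algebraMap_of_pow_card_eq {F L : Type*} [Field F] [Finite F] [Field L]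
    [Algebra F L] {x : L} (hx : x ^ Nat.card F = x) : x ∈ Set.range (algebraMap F L) := by
  have := Fintype.ofFinite F
  rw [Nat.card_eq_fintype_card] at hx
  have hs : (Polynomial.X ^ Fintype.card F - Polynomial.X : Polynomial F).Splits := by
    rw [Polynomial.splits_iff_card_roots, FiniteField.roots_X_pow_card_sub_X,
      FiniteField.X_pow_card_sub_X_natDegree_eq F Fintype.one_lt_card]
    rfl
  exact hs.mem_range_of_isRoot (FiniteField.X_pow_card_sub_X_ne_zero F Fintype.one_lt_card)
    (by simp [hx])

variable {F L : Type*} [Field F] [Field L] [Algebra F L]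

lemma sl_algebraMap_det (g : SL(2, F)) : algebraMap F L (g 0 0) * algebraMap F L (g 1 1) -
    algebraMap F L (g 0 1) * algebraMap F L (g 1 0) = 1 := by
  have := g.2
  rw [Matrix.det_fin_two] at this
  rw [← map_mul, ← map_mul, ← map_sub, this, map_one]

variable [DecidableEq L]

open OnePoint

/-- The action of `SL₂(F)` on the projective line over an extension of `F`. -/
instance projectiveLineAction : MulAction SL(2, F) (OnePoint L) :=
  MulAction.compHom (OnePoint L) (Matrix.SpecialLinearGroup.toGL.comp
    (Matrix.SpecialLinearGroup.map (n := Fin 2) (algebraMap F L)))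

lemma sl_smul_infty (g : SL(2, F)) : g • (∞ : OnePoint L) =
    if algebraMap F L (g 1 0) = 0 then ∞ else
      ((algebraMap F L (g 0 0) / algebraMap F L (g 1 0) : L) : OnePoint L) :=
  smul_infty_eq_ite _

lemma sl_smul_coe (g : SL(2, F)) (z : L) : g • (z : OnePoint L) =
    if algebraMap F L (g 1 0) * z + algebraMap F L (g 1 1) = 0 then ∞ else
      (((algebraMap F L (g 0 0) * z + algebraMap F L (g 0 1)) /
        (algebraMap F L (g 1 0) * z + algebraMap F L (g 1 1)) : L) : OnePoint L) :=
  smul_some_eq_ite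

lemma sl_smul_infty_eq_self_iff {g : SL(2, F)} :
    g • (∞ : OnePoint L) = ∞ ↔ g 1 0 = 0 := by
  rw [sl_smul_infty]
  split_ifs with h
  · simpa using h
  · simpa using h

lemma sl_smul_coe_eq_self_iff {g : SL(2, F)} {z : L} : g • (z : OnePoint L) = z ↔
    algebraMap F L (g 1 0) * (z * z) + (algebraMap F L (g 1 1) - algebraMap F L (g 0 0)) * z +
      -algebraMap F L (g 0 1) = 0 := by
  have hdet := sl_algebraMap_det (L := L) g
  rw [sl_smul_coe]
  generalize algebraMap F L (g 0 0) = a at *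
  generalize algebraMap F L (g 0 1) = b at *
  generalize algebraMap F L (g 1 0) = c at *
  generalize algebraMap F L (g 1 1) = d at *
  split_ifs with h
  · refine ⟨fun h' ↦ absurd h' (infty_ne_coe _), fun h' ↦ absurd hdet ?_⟩
    have : a * z + b = 0 := by linear_combination z * h - h'
    by_cases hc : c = 0
    · have hd : d = 0 := by rw [hc] at h; linear_combination h
      simp [hc, hd]
    · have hz : z = -d / c := by field_simp; linear_combination h
      rw [hz] at this
      field_simp at this
      intro h1
      have : (1 : L) = 0 := by rw [← h1]; linear_combination -this
      exact one_ne_zero this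
  · rw [OnePoint.coe_eq_coe, div_eq_iff h]
    exact ⟨fun h' ↦ by linear_combination -h', fun h' ↦ by linear_combination -h'⟩

/-- An element of `SL₂(F)` with distinct eigenvalues has two fixed points on the projective line
of an extension containing these eigenvalues. -/
lemma card_fixedBy_projectiveLine [NeZero (2 : L)] (g : SL(2, F)) {r : L} (hr0 : r ≠ 0)
    (hr : (algebraMap F L (g 0 0) + algebraMap F L (g 1 1)) ^ 2 - 4 = r * r) :
    Nat.card (MulAction.fixedBy (OnePoint L) g) = 2 := by
  have hdet := sl_algebraMap_det (L := L) g
  rw [Nat.card_coe_set_eq, Set.ncard_eq_two]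
  by_cases hc : g 1 0 = 0
  · rw [hc, map_zero, mul_zero, sub_zero] at hdet
    have had : algebraMap F L (g 1 1) - algebraMap F L (g 0 0) ≠ 0 := fun h ↦ by
      refine hr0 (mul_self_eq_zero.1 (hr ▸ ?_))
      linear_combination 4 * hdet + (algebraMap F L (g 1 1) - algebraMap F L (g 0 0)) * h
    refine ⟨∞, ((algebraMap F L (g 0 1) /
      (algebraMap F L (g 1 1) - algebraMap F L (g 0 0)) : L) : OnePoint L),
      infty_ne_coe _, ?_⟩
    ext z
    rw [MulAction.mem_fixedBy]
    induction z using OnePoint.rec with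
    | infty => simp [sl_smul_infty_eq_self_iff, hc]
    | coe z =>
      rw [sl_smul_coe_eq_self_iff, hc, map_zero, zero_mul, zero_add, Set.mem_insert_iff,
        Set.mem_singleton_iff, OnePoint.coe_eq_coe, eq_div_iff had]
      simp only [coe_ne_infty, false_or]
      exact ⟨fun h ↦ by linear_combination h, fun h ↦ by linear_combination h⟩
  · have hc' : algebraMap F L (g 1 0) ≠ 0 := by simpa using hc
    have h2 : (2 : L) ≠ 0 := NeZero.ne _
    have hdisc : discrim (algebraMap F L (g 1 0))
        (algebraMap F L (g 1 1) - algebraMap F L (g 0 0)) (-algebraMap F L (g 0 1)) = r * r := by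
      rw [discrim, ← hr]
      linear_combination (-4) * hdet
    refine ⟨(((-(algebraMap F L (g 1 1) - algebraMap F L (g 0 0)) + r) /
        (2 * algebraMap F L (g 1 0)) : L) : OnePoint L),
      (((-(algebraMap F L (g 1 1) - algebraMap F L (g 0 0)) - r) /
        (2 * algebraMap F L (g 1 0)) : L) : OnePoint L), fun h ↦ ?_, Set.ext fun z ↦ ?_⟩
    · rw [OnePoint.coe_eq_coe, div_left_inj' (mul_ne_zero h2 hc')] at h
      have : 2 * r = 0 := by linear_combination h
      exact hr0 ((mul_eq_zero.1 this).resolve_left h2)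
    · rw [MulAction.mem_fixedBy]
      induction z using OnePoint.rec with
      | infty => simp [sl_smul_infty_eq_self_iff, hc]
      | coe z =>
        rw [sl_smul_coe_eq_self_iff, quadratic_eq_zero_iff hc' hdisc, Set.mem_insert_iff,
          Set.mem_singleton_iff, OnePoint.coe_eq_coe, OnePoint.coe_eq_coe]

lemma smul_eq_self_of_eq_one_or_neg_one {g : SL(2, F)} (hg : g = 1 ∨ g = -1) (z : OnePoint L) :
    g • z = z := by
  rcases hg with rfl | rfl
  · exact one_smul _ z
  · induction z using OnePoint.rec with
    | infty => simp [sl_smul_infty_eq_self_iff]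
    | coe z => simp [sl_smul_coe_eq_self_iff]

/-- The stabilizer of a point `z` outside `F` acts on the line of `z` through a faithful
character with values in the elements of norm one. -/
lemma exists_stabilizer_character [Finite F] (hF : Odd (Nat.card F)) {z : L}
    (hz : z ∉ Set.range (algebraMap F L)) :
    ∃ χ : MulAction.stabilizer SL(2, F) (z : OnePoint L) →* L, Function.Injective χ ∧
      ∀ g, χ g ^ (Nat.card F + 1) = 1 := by
  have hfix (g : MulAction.stabilizer SL(2, F) (z : OnePoint L)) :=
    sl_smul_coe_eq_self_iff.1 g.2
  have indep {c d : F} (h : algebraMap F L c * z + algebraMap F L d = 0) : c = 0 ∧ d = 0 := by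
    have hc : c = 0 := by
      by_contra hc
      have hc' : algebraMap F L c ≠ 0 := by simpa using hc
      refine hz ⟨-d / c, ?_⟩
      rw [map_div₀, map_neg]
      field_simp
      linear_combination -h
    subst hc
    exact ⟨rfl, by simpa using h⟩
  refine ⟨⟨⟨fun g ↦ algebraMap F L (g.1 1 0) * z + algebraMap F L (g.1 1 1), by simp⟩,
    fun g h ↦ ?_⟩, (injective_iff_map_eq_one _).2 fun g hg ↦ ?_, fun g ↦ ?_⟩
  · have := hfix h
    simp only [Subgroup.coe_mul, Matrix.SpecialLinearGroup.coe_mul, Matrix.mul_apply,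
      Fin.sum_univ_two, map_add, map_mul]
    linear_combination (-algebraMap F L (g.1 1 0)) * this
  · change algebraMap F L (g.1 1 0) * z + algebraMap F L (g.1 1 1) = 1 at hg
    obtain ⟨hc, hd⟩ := indep (c := g.1 1 0) (d := g.1 1 1 - 1)
      (by rw [map_sub, map_one]; linear_combination hg)
    have hd : g.1 1 1 = 1 := by linear_combination hd
    have ha : g.1 0 0 = 1 := by
      have := g.1.2
      rw [Matrix.det_fin_two, hc, hd] at this
      simpa using this
    have hb : g.1 0 1 = 0 := by simpa [hc, hd, ha] using hfix g
    refine Subtype.ext ?_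
    ext1 i j
    fin_cases i <;> fin_cases j
    exacts [ha, hb, hc, hd]
  · change (algebraMap F L (g.1 1 0) * z + algebraMap F L (g.1 1 1)) ^ (Nat.card F + 1) = 1
    have := Fintype.ofFinite F
    have hdet := sl_algebraMap_det (L := L) g.1
    set w := algebraMap F L (g.1 1 0) * z + algebraMap F L (g.1 1 1) with hw
    have hchar : w * w - algebraMap F L (g.1 0 0 + g.1 1 1) * w + 1 = 0 := by
      rw [map_add, hw]
      linear_combination algebraMap F L (g.1 1 0) * hfix g - hdet
    obtain ⟨p, _⟩ := CharP.exists F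
    have : CharP L p := charP_of_injective_algebraMap (algebraMap F L).injective p
    obtain ⟨n, hp, hn⟩ := FiniteField.card F p
    have : Fact p.Prime := ⟨hp⟩
    rw [← Nat.card_eq_fintype_card] at hn
    have hfrob (t : F) : algebraMap F L t ^ Nat.card F = algebraMap F L t := by
      rw [← map_pow, Nat.card_eq_fintype_card, FiniteField.pow_card]
    have hchar' : w ^ Nat.card F * w ^ Nat.card F -
        algebraMap F L (g.1 0 0 + g.1 1 1) * w ^ Nat.card F + 1 = 0 := by
      have := congrArg (iterateFrobenius L p n) hchar
      simp only [map_add, map_sub, map_mul, map_zero, map_one] at this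
      simp only [iterateFrobenius_def, ← hn, hfrob, ← map_add] at this
      exact this
    rcases eq_or_ne (w ^ Nat.card F) w with h | h
    · obtain ⟨e, he⟩ := mem_range_algebraMap_of_pow_card_eq h
      obtain ⟨hc, hd⟩ := indep (c := g.1 1 0) (d := g.1 1 1 - e)
        (by rw [map_sub, he, hw]; ring)
      have hfg := hfix g
      rw [hc, map_zero, zero_mul, zero_add, ← map_sub, ← map_neg] at hfg
      have had := (indep hfg).1
      rw [hc, map_zero, mul_zero, sub_zero] at hdet
      have hw' : w = algebraMap F L (g.1 1 1) := by rw [hw, hc, map_zero, zero_mul, zero_add]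
      have hsq : w ^ 2 = 1 := by rw [← hdet, hw', sub_eq_zero.1 had, sq]
      obtain ⟨k, hk⟩ := hF
      rw [hk, show 2 * k + 1 + 1 = 2 * (k + 1) by ring, pow_mul, hsq, one_pow]
    · have : (w ^ Nat.card F - w) * (w ^ Nat.card F + w - algebraMap F L (g.1 0 0 + g.1 1 1)) = 0 :=
        by linear_combination hchar' - hchar
      have := (mul_eq_zero.1 this).resolve_left (sub_ne_zero.2 h)
      rw [pow_succ]
      linear_combination w * this - hchar

end ProjectiveLine

/-! ### Subgroups of `SL₂(F)` transitive on the projective line -/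

section TransitiveSubgroup

lemma sl_eq_one_or_neg_one_of_mul_self {R : Type*} [Field R] [NeZero (2 : R)] {g : SL(2, R)}
    (hg : g * g = 1) : g = 1 ∨ g = -1 := by
  have h2 : (2 : R) ≠ 0 := NeZero.ne _
  have hdet := g.2
  rw [Matrix.det_fin_two] at hdet
  have key (i j : Fin 2) : g i 0 * g 0 j + g i 1 * g 1 j = (1 : Matrix (Fin 2) (Fin 2) R) i j := by
    rw [← Matrix.SpecialLinearGroup.coe_one, ← hg, Matrix.SpecialLinearGroup.coe_mul,
      Matrix.mul_apply, Fin.sum_univ_two]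
  have h00 : g 0 0 * g 0 0 + g 0 1 * g 1 0 = 1 := key 0 0
  have h01 : g 0 0 * g 0 1 + g 0 1 * g 1 1 = 0 := key 0 1
  have h10 : g 1 0 * g 0 0 + g 1 1 * g 1 0 = 0 := key 1 0
  have h11 : g 1 0 * g 0 1 + g 1 1 * g 1 1 = 1 := key 1 1
  have htr : g 0 0 + g 1 1 ≠ 0 := fun h ↦ by
    have : (2 : R) * 2 = 0 := by
      linear_combination (g 0 0 + g 1 1) * h - h00 - h11 - 2 * hdet
    simp [h2] at this
  have hb : g 0 1 = 0 := by
    refine (mul_eq_zero.1 (?_ : (g 0 0 + g 1 1) * g 0 1 = 0)).resolve_left htr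
    linear_combination h01
  have hc : g 1 0 = 0 := by
    refine (mul_eq_zero.1 (?_ : (g 0 0 + g 1 1) * g 1 0 = 0)).resolve_left htr
    linear_combination h10
  rw [hb, zero_mul, add_zero] at h00
  rw [hb, zero_mul, sub_zero] at hdet
  rcases mul_self_eq_one_iff.1 h00 with ha | ha <;> rw [ha] at hdet
  · left
    ext i j
    fin_cases i <;> fin_cases j
    exacts [ha, hb, hc, by simpa using hdet]
  · right
    ext i j
    fin_cases i <;> fin_cases j
    · exact ha
    · simpa using hb
    · simpa using hc
    · simpa [neg_eq_iff_eq_neg] using hdet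

lemma sl_neg_one_ne_one {R : Type*} [Field R] [NeZero (2 : R)] : (-1 : SL(2, R)) ≠ 1 := fun h ↦ by
  have h2 : (2 : R) ≠ 0 := NeZero.ne _
  have : (-1 : SL(2, R)) 0 0 = (1 : SL(2, R)) 0 0 := by rw [h]
  simp only [Matrix.SpecialLinearGroup.coe_neg, Matrix.SpecialLinearGroup.coe_one,
    Matrix.neg_apply, Matrix.one_apply_eq] at this
  exact h2 (by linear_combination -this)

variable {F : Type*} [Field F]

lemma sl_pow_eq_one_of_trace {p : ℕ} [Fact p.Prime] [CharP F p] {g : SL(2, F)}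
    (htr : (g 0 0 + g 1 1) ^ 2 - 4 = 0) : (g * g) ^ p = 1 := by
  obtain ⟨e, he, hge⟩ : ∃ e : F, e * e = 1 ∧ g 0 0 + g 1 1 = 2 * e := by
    have : (g 0 0 + g 1 1 - 2) * (g 0 0 + g 1 1 + 2) = 0 := by linear_combination htr
    rcases mul_eq_zero.1 this with h | h
    · exact ⟨1, by ring, by linear_combination h⟩
    · exact ⟨-1, by ring, by linear_combination h⟩
  have hdet := g.2
  rw [Matrix.det_fin_two] at hdet
  have hnil : (g.1 - Matrix.scalar (Fin 2) e) ^ 2 = 0 := by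
    ext i j
    rw [sq, Matrix.mul_apply, Fin.sum_univ_two]
    fin_cases i <;> fin_cases j <;> simp
    · linear_combination g 0 0 * hge - hdet + he
    · linear_combination g 0 1 * hge
    · linear_combination g 1 0 * hge
    · linear_combination g 1 1 * hge - hdet + he
  have hp : (g.1 - Matrix.scalar (Fin 2) e) ^ p = 0 :=
    pow_eq_zero_of_le (Fact.out : p.Prime).two_le hnil
  rw [sub_pow_char_of_commute _ (Matrix.scalar_commute e (Commute.all e) _).symm, sub_eq_zero] at hp
  ext1 i j
  rw [← sq, ← pow_mul, mul_comm, pow_mul, Matrix.SpecialLinearGroup.coe_pow,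
    Matrix.SpecialLinearGroup.coe_pow, hp, ← pow_mul, mul_comm, pow_mul, ← map_pow, sq, he]
  simp

/-- The subgroup generated by an involution. -/
def involutionSubgroup {G : Type*} [Group G] (z : G) (hz : z * z = 1) : Subgroup G where
  carrier := {1, z}
  one_mem' := .inl rfl
  mul_mem' := by
    rintro _ _ (rfl | rfl) (rfl | rfl) <;> simp [hz]
  inv_mem' := by
    rintro _ (rfl | rfl)
    · simp
    · exact .inr (inv_eq_of_mul_eq_one_left hz)

lemma exists_quadratic_extension.{u} (F : Type u) [Field F] [Finite F] (hq : Nat.card F % 4 = 3) :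
    ∃ (L : Type u) (_ : Field L) (_ : Algebra F L), Finite L ∧
      ∀ d : F, ∃ r : L, algebraMap F L d = r * r := by
  have := Fintype.ofFinite F
  have hns : ¬ IsSquare (-1 : F) := by
    rw [FiniteField.isSquare_neg_one_iff, ← Nat.card_eq_fintype_card]
    omega
  have : Fact (∀ r : F, r ^ 2 ≠ -1 + 0 * r) :=
    ⟨fun r hr ↦ hns ⟨r, by rw [← sq, hr, zero_mul, add_zero]⟩⟩
  refine ⟨QuadraticAlgebra F (-1) 0, inferInstance, inferInstance,
    Module.finite_of_finite F, fun d ↦ ?_⟩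
  classical
  have hchar : ringChar F ≠ 2 := fun h ↦ by
    have := FiniteField.even_card_of_char_two h
    rw [← Nat.card_eq_fintype_card] at this
    omega
  have : IsSquare d ∨ IsSquare (-d) := by
    by_contra! h
    have h1 := quadraticChar_neg_one_iff_not_isSquare.2 h.1
    have h2 := quadraticChar_neg_one_iff_not_isSquare.2 h.2
    have h3 := quadraticChar_neg_one_iff_not_isSquare.2 hns
    rw [neg_eq_neg_one_mul, map_mul, h1, h3] at h2
    norm_num at h2
  rcases this with ⟨e, he⟩ | ⟨e, he⟩
  · exact ⟨algebraMap _ _ e, by rw [he, map_mul]⟩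
  · refine ⟨⟨0, e⟩, ?_⟩
    rw [neg_eq_iff_eq_neg.1 he]
    ext <;> simp

section Orbits

open OnePoint MulAction

variable {L : Type*} [Field L] [Algebra F L] [DecidableEq L] {H : Subgroup SL(2, F)}

lemma orbit_infty_eq (htrans : ∀ z : F, ∃ g ∈ H, g 1 0 ≠ 0 ∧ g 0 0 = z * g 1 0) :
    orbit H (∞ : OnePoint L) =
      insert ∞ (Set.range fun z : F ↦ ((algebraMap F L z : L) : OnePoint L)) := by
  refine Set.Subset.antisymm ?_ (Set.insert_subset (mem_orbit_self _) ?_)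
  · rintro _ ⟨g, rfl⟩
    change g.1 • (∞ : OnePoint L) ∈ _
    rw [sl_smul_infty]
    split_ifs with h
    · exact .inl rfl
    · exact .inr ⟨g.1 0 0 / g.1 1 0, by simp⟩
  · rintro _ ⟨z, rfl⟩
    obtain ⟨g, hg, hc, ha⟩ := htrans z
    refine ⟨⟨g, hg⟩, ?_⟩
    change g • (∞ : OnePoint L) = _
    rw [sl_smul_infty, if_neg (by simpa using hc), ← map_div₀, ha, mul_div_cancel_right₀ _ hc]

lemma card_eq_mul_card_stabilizer [Finite F]
    (htrans : ∀ z : F, ∃ g ∈ H, g 1 0 ≠ 0 ∧ g 0 0 = z * g 1 0) {z : OnePoint L}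
    (hz : z ∈ orbit H (∞ : OnePoint L)) :
    Nat.card H = Nat.card (stabilizer H z) * (Nat.card F + 1) := by
  rw [← Subgroup.card_mul_index (stabilizer H z), index_stabilizer, orbit_eq_iff.2 hz,
    orbit_infty_eq htrans, Set.ncard_insert_of_notMem (by simp), Set.ncard_range_of_injective]
  exact coe_injective.comp (algebraMap F L).injective

lemma isCyclic_stabilizer [Finite F] (hF : Odd (Nat.card F)) {z : L}
    (hz : z ∉ Set.range (algebraMap F L)) :
    IsCyclic (stabilizer H (z : OnePoint L)) ∧
      Nat.card (stabilizer H (z : OnePoint L)) ∣ Nat.card F + 1 := by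
  obtain ⟨χ, hinj, hχ⟩ := exists_stabilizer_character hF hz
  let f : stabilizer H (z : OnePoint L) →* stabilizer SL(2, F) (z : OnePoint L) :=
    (H.subtype.comp (Subgroup.subtype _)).codRestrict _ fun g ↦ g.2
  have hf : Function.Injective f := fun x y h ↦
    Subtype.ext (Subtype.ext (congrArg (fun g ↦ g.1) h))
  have hχf : Function.Injective (χ.comp f) := hinj.comp hf
  have := isCyclic_of_injective_ringHom (χ.comp f) hχf
  refine ⟨this, ?_⟩
  obtain ⟨t, ht⟩ := IsCyclic.exists_ofOrder_eq_natCard (α := stabilizer H (z : OnePoint L))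
  rw [← ht, ← orderOf_injective _ hχf t]
  exact orderOf_dvd_of_pow_eq_one (hχ _)

end Orbits

section Structure

open OnePoint MulAction

variable {H : Subgroup SL(2, F)}

lemma neZero_two_of_odd_card [Finite F] (hF : Odd (Nat.card F)) : NeZero (2 : F) := by
  have := Fintype.ofFinite F
  refine ⟨Ring.two_ne_zero fun h ↦ ?_⟩
  have := FiniteField.even_card_of_char_two h
  rw [← Nat.card_eq_fintype_card] at this
  have := Nat.odd_iff.1 hF
  omega

lemma eq_one_or_neg_one_of_trace [NeZero (2 : F)] {p : ℕ} [Fact p.Prime] [CharP F p]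
    (hp : ∀ g ∈ H, g ^ p = 1 → g = 1) {g : SL(2, F)} (hg : g ∈ H)
    (htr : (g 0 0 + g 1 1) ^ 2 - 4 = 0) : g = 1 ∨ g = -1 :=
  sl_eq_one_or_neg_one_of_mul_self
    (hp (g * g) (H.mul_mem hg hg) (sl_pow_eq_one_of_trace htr))

lemma neg_one_mem_of_even_card [Finite F] [NeZero (2 : F)] (hH : 2 ∣ Nat.card H) :
    (-1 : SL(2, F)) ∈ H := by
  obtain ⟨x, hx⟩ := exists_prime_orderOf_dvd_card' 2 hH
  have h1 : x.1 * x.1 = 1 := by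
    rw [← sq]
    exact congrArg Subtype.val (hx ▸ pow_orderOf_eq_one x)
  rcases sl_eq_one_or_neg_one_of_mul_self h1 with h | h
  · rw [show x = 1 from Subtype.ext h, orderOf_one] at hx
    omega
  · exact h ▸ x.2

/-- A subgroup of `SL₂(F)` without elements of order `p` and transitive on the projective line
over `F` fixes a pair of points that are not defined over `F`. -/
lemma exists_card_stabilizer_eq [Finite F] {p : ℕ} [Fact p.Prime] [CharP F p]
    (hq : Nat.card F % 4 = 3) (hq7 : Nat.card F ≠ 7) (hq11 : Nat.card F ≠ 11)
    (hq19 : Nat.card F ≠ 19) (hq23 : Nat.card F ≠ 23) (hq59 : Nat.card F ≠ 59)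
    (hp : ∀ g ∈ H, g ^ p = 1 → g = 1)
    (htrans : ∀ z : F, ∃ g ∈ H, g 1 0 ≠ 0 ∧ g 0 0 = z * g 1 0)
    {L : Type*} [Field L] [Algebra F L] [Finite L] [DecidableEq L]
    (hfix : ∀ g ∈ H, g ≠ 1 → g ≠ -1 → Nat.card (fixedBy (OnePoint L) g) = 2) :
    Nat.card (stabilizer H (∞ : OnePoint L)) = 2 ∧ ∃ z : L, z ∉ Set.range (algebraMap F L) ∧
      Nat.card (stabilizer H (z : OnePoint L)) = Nat.card F + 1 := by
  have hF : Odd (Nat.card F) := Nat.odd_iff.2 (by omega)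
  have := neZero_two_of_odd_card hF
  have : Finite (OnePoint L) := inferInstanceAs (Finite (Option L))
  have hcard := card_eq_mul_card_stabilizer (L := L) htrans (mem_orbit_self _)
  have hneg : (-1 : SL(2, F)) ∈ H := neg_one_mem_of_even_card <| by
    rw [hcard]
    exact Dvd.dvd.mul_left (by omega) _
  let Z : Subgroup H := involutionSubgroup ⟨-1, hneg⟩ (by ext1; simp)
  have hZ (g : H) : g ∈ Z ↔ g.1 = 1 ∨ g.1 = -1 := or_congr Subtype.ext_iff Subtype.ext_iff
  have hZ2 : Nat.card Z = 2 :=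
    (Nat.card_coe_set_eq _).trans (Set.ncard_pair fun h ↦
      sl_neg_one_ne_one (congrArg Subtype.val h).symm)
  have htriv (g : H) (hg : g ∈ Z) (z : OnePoint L) : g • z = z :=
    smul_eq_self_of_eq_one_or_neg_one ((hZ g).1 hg) z
  have hdvd : 2 ∣ Nat.card (stabilizer H (∞ : OnePoint L)) :=
    hZ2.symm.dvd.trans (Subgroup.card_dvd_of_le fun g hg ↦ htriv g hg _)
  have hpos : 0 < Nat.card (stabilizer H (∞ : OnePoint L)) := Nat.card_pos
  have hq0 : 3 ≤ Nat.card F := by omega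
  have hge : 2 * (Nat.card F + 1) ≤ Nat.card H := by
    rw [hcard]
    exact Nat.mul_le_mul_right _ (Nat.le_of_dvd hpos hdvd)
  have horb {z : F} : ((algebraMap F L z : L) : OnePoint L) ∈ orbit H (∞ : OnePoint L) := by
    rw [orbit_infty_eq htrans]
    exact .inr ⟨z, rfl⟩
  have hrat {z : OnePoint L} (hz : z ∈ orbit H (∞ : OnePoint L)) :
      2 * Nat.card (stabilizer H z) < Nat.card H := by
    rw [card_eq_mul_card_stabilizer htrans hz, mul_comm]
    exact Nat.mul_lt_mul_of_pos_left (by omega) Nat.card_pos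
  have hirr {z : L} (hz : z ∉ Set.range (algebraMap F L)) :
      Nat.card (stabilizer H (z : OnePoint L)) ≤ Nat.card F + 1 :=
    Nat.le_of_dvd (by omega) (isCyclic_stabilizer hF hz).2
  rcases exists_two_mul_card_stabilizer_eq (Ω := OnePoint L) Z hZ2 htriv
    (fun g hg ↦ hfix g g.2 (fun h ↦ hg ((hZ g).2 (.inl h))) fun h ↦ hg ((hZ g).2 (.inr h)))
    (fun z ↦ by
      induction z using OnePoint.rec with
      | infty => exact (hrat (mem_orbit_self _)).le
      | coe z =>
        by_cases hz : z ∈ Set.range (algebraMap F L)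
        · obtain ⟨z, rfl⟩ := hz
          exact (hrat horb).le
        · exact (Nat.mul_le_mul_left 2 (hirr hz)).trans hge) with ⟨z, hz⟩ | h
  · induction z using OnePoint.rec with
    | infty => exact absurd hz (hrat (mem_orbit_self _)).ne
    | coe z =>
      by_cases hzF : z ∈ Set.range (algebraMap F L)
      · obtain ⟨z, rfl⟩ := hzF
        exact absurd hz (hrat horb).ne
      · have h1 : Nat.card (stabilizer H (z : OnePoint L)) = Nat.card F + 1 := by
          have := hirr hzF
          omega
        refine ⟨?_, z, hzF, h1⟩
        rw [← hz, h1] at hcard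
        exact (Nat.eq_of_mul_eq_mul_right (by omega) hcard).symm
  · obtain ⟨k, hk⟩ := hdvd
    rw [hk] at hcard
    have hd : Nat.card F + 1 ∣ Nat.card H / 2 := ⟨k, by
      rw [hcard, mul_assoc, Nat.mul_div_cancel_left _ two_pos, mul_comm]⟩
    have h3 : Nat.card F = 3 := by
      have h59 : Nat.card F ≤ 59 := by
        have := Nat.le_of_dvd (by omega) hd
        omega
      generalize Nat.card F = q at hq hq7 hq11 hq19 hq23 hq59 hq0 hd h59 ⊢
      rcases h with h | h | h <;> rw [h] at hd <;> interval_cases q <;> revert hd <;> omega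
    have hp3 : p ∣ 3 := by
      have := Fintype.ofFinite F
      rw [← h3, Nat.card_eq_fintype_card]
      exact (CharP.cast_eq_zero_iff F p _).1 (FiniteField.cast_card_eq_zero F)
    obtain ⟨x, hx⟩ := exists_prime_orderOf_dvd_card' (G := H) p (hp3.trans (by omega))
    have hx1 := hp x x.2 (by
      rw [← Subgroup.coe_pow, ← hx, pow_orderOf_eq_one, Subgroup.coe_one])
    rw [show x = 1 from Subtype.ext hx1, orderOf_one] at hx
    exact absurd hx.symm (Fact.out : p.Prime).ne_one

/-- A subgroup of `SL₂(F)` without elements of order `p` and transitive on the projective line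
over `F` is a generalized dicyclic group of order `2 (q + 1)`, and point stabilizers are central. -/
theorem dicyclic_of_transitive [Finite F] {p : ℕ} [Fact p.Prime] [CharP F p]
    (hq : Nat.card F % 4 = 3) (hq7 : Nat.card F ≠ 7) (hq11 : Nat.card F ≠ 11)
    (hq19 : Nat.card F ≠ 19) (hq23 : Nat.card F ≠ 23) (hq59 : Nat.card F ≠ 59)
    (hp : ∀ g ∈ H, g ^ p = 1 → g = 1)
    (htrans : ∀ z : F, ∃ g ∈ H, g 1 0 ≠ 0 ∧ g 0 0 = z * g 1 0) :
    IsGeneralizedDicyclic (-1) H (Nat.card F + 1) ∧ ∀ g ∈ H, g 1 0 = 0 → g = 1 ∨ g = -1 := by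
  classical
  have hF : Odd (Nat.card F) := Nat.odd_iff.2 (by omega)
  have := neZero_two_of_odd_card hF
  obtain ⟨L, _, _, _, hL⟩ := exists_quadratic_extension F hq
  have : Finite (OnePoint L) := inferInstanceAs (Finite (Option L))
  have : NeZero (2 : L) := ⟨by rw [← map_ofNat (algebraMap F L)]; simpa using NeZero.ne (2 : F)⟩
  have hfix (g : SL(2, F)) (hg : g ∈ H) (h1 : g ≠ 1) (h2 : g ≠ -1) :
      Nat.card (fixedBy (OnePoint L) g) = 2 := by
    obtain ⟨r, hr⟩ := hL ((g 0 0 + g 1 1) ^ 2 - 4)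
    refine card_fixedBy_projectiveLine g (r := r) ?_ ?_
    · rintro rfl
      rw [mul_zero, map_eq_zero] at hr
      exact (eq_one_or_neg_one_of_trace hp hg hr).elim h1 h2
    · rw [← hr, map_sub, map_pow, map_add, map_ofNat]
  obtain ⟨h2, z, hz, hcardz⟩ :=
    exists_card_stabilizer_eq hq hq7 hq11 hq19 hq23 hq59 hp htrans hfix
  have hcard := card_eq_mul_card_stabilizer (L := L) htrans (mem_orbit_self _)
  rw [h2] at hcard
  have hneg : (-1 : SL(2, F)) ∈ H := neg_one_mem_of_even_card ⟨_, hcard⟩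
  refine ⟨⟨hneg, hcard, ?_⟩, fun g hg hc ↦ ?_⟩
  · obtain ⟨t, ht⟩ := (isCyclic_stabilizer (H := H) hF hz).1.exists_generator
    refine ⟨t, t.1.2, ?_, fun x hx hxt ↦ ?_⟩
    · rw [Subgroup.orderOf_coe, Subgroup.orderOf_coe, orderOf_eq_card_of_forall_mem_zpowers ht,
        hcardz]
    have hxz : x • (z : OnePoint L) ≠ z := fun h ↦ hxt <| by
      obtain ⟨k, hk⟩ := ht ⟨⟨x, hx⟩, h⟩
      exact ⟨k, by simpa using congrArg (fun y ↦ y.1.1) hk⟩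
    have hindex : (stabilizer H (z : OnePoint L)).index = 2 := by
      have := Subgroup.card_mul_index (stabilizer H (z : OnePoint L))
      rw [hcardz, hcard, mul_comm] at this
      exact Nat.eq_of_mul_eq_mul_right (by omega) this
    have hxx : (x * x) • (z : OnePoint L) = z :=
      Subgroup.mul_self_mem_of_index_two hindex ⟨x, hx⟩
    have hx1 (h : x = 1 ∨ x = -1) : False := hxz (smul_eq_self_of_eq_one_or_neg_one h _)
    by_contra hne
    have hxfix := hfix x hx (fun h ↦ hx1 (.inl h)) (fun h ↦ hx1 (.inr h))
    have hxxfix := hfix (x * x) (H.mul_mem hx hx)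
      (fun h ↦ hx1 (sl_eq_one_or_neg_one_of_mul_self h)) hne
    obtain ⟨w, hw⟩ : (fixedBy (OnePoint L) x).Nonempty :=
      Set.nonempty_of_ncard_ne_zero (by rw [← Nat.card_coe_set_eq, hxfix]; exact two_ne_zero)
    rw [mem_fixedBy] at hw
    have hwz : w ≠ z := fun h ↦ hxz (h ▸ hw)
    have hwxz : w ≠ x • (z : OnePoint L) := fun h ↦ hxz (by
      have := h ▸ hw
      exact (smul_left_cancel x this))
    have hsub : {w, (z : OnePoint L), x • (z : OnePoint L)} ⊆ fixedBy (OnePoint L) (x * x) := by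
      rintro _ (rfl | rfl | rfl)
      · rw [mem_fixedBy, mul_smul, hw, hw]
      · exact hxx
      · rw [mem_fixedBy, ← mul_smul, mul_assoc, mul_smul, hxx]
    have := Set.ncard_le_ncard hsub
    rw [← Nat.card_coe_set_eq (fixedBy _ _), hxxfix, Set.ncard_eq_three.2
      ⟨w, z, _, hwz, hwxz, hxz.symm, rfl⟩] at this
    omega
  · by_contra! hg1
    let σ (x : SL(2, F)) (hx : x ∈ H) (hx0 : x 1 0 = 0) : stabilizer H (∞ : OnePoint L) :=
      ⟨⟨x, hx⟩, sl_smul_infty_eq_self_iff.2 hx0⟩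
    have hσ := ((Nat.card_eq_two_iff' 1).1 h2).unique
      (y₁ := σ g hg hc) (y₂ := σ (-1) hneg (by simp))
      (fun h ↦ hg1.1 (congrArg (fun y ↦ y.1.1) h))
      (fun h ↦ sl_neg_one_ne_one (congrArg (fun y ↦ y.1.1) h))
    exact hg1.2 (congrArg (fun y ↦ y.1.1) hσ)

end Structure

end TransitiveSubgroup

/-! ### Edge-transitive pairs -/

section EdgeTransitivePair

variable {F : Type*} [Field F] {A₁ A₂ : Subgroup SL(2, LaurentSeries F)}

lemma neZero_two_laurentSeries [NeZero (2 : F)] : NeZero (2 : LaurentSeries F) :=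
  ⟨by
    rw [← map_ofNat (algebraMap F (LaurentSeries F)), Ne, map_eq_zero]
    exact NeZero.ne (2 : F)⟩

lemma parahoricSwap_neg_one : parahoricSwap F (-1) = -1 := by
  ext1 i j
  fin_cases i <;> fin_cases j
  · change (-1 : SL(2, LaurentSeries F)) 1 1 = (-1 : SL(2, LaurentSeries F)) 0 0
    simp
  · change -((-1 : SL(2, LaurentSeries F)) 1 0) / laurentVar F = (-1 : SL(2, LaurentSeries F)) 0 1
    simp
  · change -laurentVar F * (-1 : SL(2, LaurentSeries F)) 0 1 = (-1 : SL(2, LaurentSeries F)) 1 0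
    simp
  · change (-1 : SL(2, LaurentSeries F)) 0 0 = (-1 : SL(2, LaurentSeries F)) 1 1
    simp

theorem IsEdgeTransitivePair.isGeneralizedDicyclic [Finite F] (h : IsEdgeTransitivePair A₁ A₂)
    [Finite A₁] (hq : Nat.card F % 4 = 3) (hq7 : Nat.card F ≠ 7) (hq11 : Nat.card F ≠ 11)
    (hq19 : Nat.card F ≠ 19) (hq23 : Nat.card F ≠ 23) (hq59 : Nat.card F ≠ 59) :
    IsGeneralizedDicyclic (-1) A₁ (Nat.card F + 1) ∧
      ∀ g ∈ A₁, g ∈ parahoricTwo F → g = 1 ∨ g = -1 := by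
  have := neZero_two_of_odd_card (F := F) (Nat.odd_iff.2 (by omega))
  have := neZero_two_laurentSeries (F := F)
  obtain ⟨p, _⟩ := CharP.exists F
  have : Fact p.Prime := ⟨CharP.char_is_prime F p⟩
  obtain ⟨ψ, hψ, htwo, htrans⟩ := h.exists_reduction p
  obtain ⟨hdic, hstab⟩ := dicyclic_of_transitive (p := p) (H := ψ.range) hq hq7 hq11 hq19 hq23 hq59
    (by
      rintro _ ⟨x, rfl⟩ hx
      rw [← map_pow] at hx
      have hxp : x ^ p = 1 := hψ (hx.trans (map_one ψ).symm)
      have := h.eq_one_of_pow_eq_one p x.2 1 (by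
        rw [pow_one, ← Subgroup.coe_pow, hxp, Subgroup.coe_one])
      rw [show x = 1 from Subtype.ext this, map_one])
    fun z ↦ by
      obtain ⟨x, hx⟩ := htrans z
      exact ⟨_, ⟨x, rfl⟩, hx⟩
  have hneg (x : A₁) (hx : ψ x = -1) : x.1 = -1 := by
    have hxx : x * x = 1 := hψ (by rw [map_mul, hx, map_one]; simp)
    refine (sl_eq_one_or_neg_one_of_mul_self (congrArg Subtype.val hxx)).resolve_left fun h1 ↦ ?_
    rw [show x = 1 from Subtype.ext h1, map_one] at hx
    exact sl_neg_one_ne_one hx.symm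
  refine ⟨hdic.of_range hψ hneg, fun g hg hgtwo ↦ ?_⟩
  refine (hstab _ ⟨⟨g, hg⟩, rfl⟩ (htwo _ hgtwo)).imp (fun h1 ↦ ?_) (hneg _)
  exact congrArg Subtype.val (hψ (h1.trans (map_one ψ).symm))

theorem IsEdgeTransitivePair.isGeneralizedDicyclic_right [Finite F]
    (h : IsEdgeTransitivePair A₁ A₂) [Finite A₂] (hq : Nat.card F % 4 = 3)
    (hq7 : Nat.card F ≠ 7) (hq11 : Nat.card F ≠ 11) (hq19 : Nat.card F ≠ 19)
    (hq23 : Nat.card F ≠ 23) (hq59 : Nat.card F ≠ 59) :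
    IsGeneralizedDicyclic (-1) A₂ (Nat.card F + 1) := by
  let φ := (parahoricSwap F).toMonoidHom.comp A₂.subtype
  have hφ : φ.range = A₂.map (parahoricSwap F).toMonoidHom := by
    rw [MonoidHom.range_comp, Subgroup.range_subtype]
  have : Finite (A₂.map (parahoricSwap F).toMonoidHom) := Finite.Set.finite_image _ _
  have := (h.swap.isGeneralizedDicyclic hq hq7 hq11 hq19 hq23 hq59).1
  rw [← hφ] at this
  exact this.of_range ((parahoricSwap F).injective.comp A₂.subtype_injective) fun x hx ↦
    (parahoricSwap F).injective (hx.trans parahoricSwap_neg_one.symm)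

lemma sl_mem_center_iff {K : Type*} [Field K] {g : SL(2, K)} :
    g ∈ Subgroup.center SL(2, K) ↔ g = 1 ∨ g = -1 := by
  rw [Matrix.SpecialLinearGroup.mem_center_iff, Fintype.card_fin]
  constructor
  · rintro ⟨r, hr, hg⟩
    rcases mul_self_eq_one_iff.1 ((sq r).symm.trans hr) with rfl | rfl
    · exact .inl (Subtype.ext (by rw [← hg, map_one, Matrix.SpecialLinearGroup.coe_one]))
    · exact .inr (Subtype.ext (by
        rw [← hg, map_neg, map_one, Matrix.SpecialLinearGroup.coe_neg,
          Matrix.SpecialLinearGroup.coe_one]))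
  · rintro (rfl | rfl)
    · exact ⟨1, one_pow 2, by simp⟩
    · exact ⟨-1, by simp, by
        rw [map_neg, map_one, Matrix.SpecialLinearGroup.coe_neg,
          Matrix.SpecialLinearGroup.coe_one]⟩

end EdgeTransitivePair

/-- Let `p` be an odd prime, `q = p^a ≡ 3 (mod 4)` with
`q ∉ {7, 11, 19, 23, 59}`, `K = 𝔽_q((u))`, and `P₁, P₂, B` the standard parahoric and
Iwahori subgroups of `SL₂(K)`.  If `A₁ ≤ P₁` and `A₂ ≤ P₂` are finite subgroups with
`P_i = A_i · B` and `A_i ∩ P_{3-i} = A₁ ∩ A₂` for `i = 1, 2`, then `-I ∈ A_i`, each `A_i`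
has order `2(q+1)`, `A₁ ∩ A₂ = {I, -I}`, and `A_i/⟨-I⟩` (i.e. the image of `A_i` in
`SL₂(K)` modulo its centre, which is `⟨-I⟩`) is dihedral of order `q + 1`. -/
theorem edge_transitive_lattice_q_three_mod_four (p a : ℕ) [Fact p.Prime]
    (hodd : Odd p) (ha : 1 ≤ a) (hq : p ^ a % 4 = 3)
    (hq7 : p ^ a ≠ 7) (hq11 : p ^ a ≠ 11) (hq19 : p ^ a ≠ 19) (hq23 : p ^ a ≠ 23)
    (hq59 : p ^ a ≠ 59)
    (A₁ A₂ : Subgroup (Matrix.SpecialLinearGroup (Fin 2)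
      (LaurentSeries (GaloisField p a))))
    (hfin₁ : Finite A₁) (hfin₂ : Finite A₂)
    (hA₁ : (↑A₁ : Set _) ⊆ parahoricOne (GaloisField p a))
    (hA₂ : (↑A₂ : Set _) ⊆ parahoricTwo (GaloisField p a))
    (hcover₁ : ∀ g ∈ parahoricOne (GaloisField p a),
      ∃ x ∈ A₁, ∃ b ∈ iwahori (GaloisField p a), g = x * b)
    (hcover₂ : ∀ g ∈ parahoricTwo (GaloisField p a),
      ∃ x ∈ A₂, ∃ b ∈ iwahori (GaloisField p a), g = x * b)
    (hint₁ : (↑A₁ : Set _) ∩ parahoricTwo (GaloisField p a) = ↑(A₁ ⊓ A₂))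
    (hint₂ : (↑A₂ : Set _) ∩ parahoricOne (GaloisField p a) = ↑(A₁ ⊓ A₂)) :
    (-1 : Matrix.SpecialLinearGroup (Fin 2) (LaurentSeries (GaloisField p a))) ∈ A₁ ∧
    (-1 : Matrix.SpecialLinearGroup (Fin 2) (LaurentSeries (GaloisField p a))) ∈ A₂ ∧
    Nat.card A₁ = 2 * (p ^ a + 1) ∧ Nat.card A₂ = 2 * (p ^ a + 1) ∧
    (↑(A₁ ⊓ A₂) : Set (Matrix.SpecialLinearGroup (Fin 2)
        (LaurentSeries (GaloisField p a)))) = {1, -1} ∧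
    Nonempty ((A₁.map (QuotientGroup.mk' (Subgroup.center
        (Matrix.SpecialLinearGroup (Fin 2) (LaurentSeries (GaloisField p a)))))) ≃*
      DihedralGroup ((p ^ a + 1) / 2)) ∧
    Nonempty ((A₂.map (QuotientGroup.mk' (Subgroup.center
        (Matrix.SpecialLinearGroup (Fin 2) (LaurentSeries (GaloisField p a)))))) ≃*
      DihedralGroup ((p ^ a + 1) / 2)) := by
  have hcard : Nat.card (GaloisField p a) = p ^ a := GaloisField.card p a (by omega)
  have h : IsEdgeTransitivePair A₁ A₂ :=
    ⟨fun _ hg ↦ hA₁ hg, fun _ hg ↦ hA₂ hg, hcover₁, hcover₂,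
      fun _ h1 h2 ↦ (hint₁.subset ⟨h1, h2⟩).2, fun _ h1 h2 ↦ (hint₂.subset ⟨h1, h2⟩).1⟩
  rw [← hcard] at hq hq7 hq11 hq19 hq23 hq59 ⊢
  have := neZero_two_of_odd_card (F := GaloisField p a) (Nat.odd_iff.2 (by omega))
  have := neZero_two_laurentSeries (F := GaloisField p a)
  obtain ⟨hdic₁, hinf⟩ := h.isGeneralizedDicyclic hq hq7 hq11 hq19 hq23 hq59
  have hdic₂ := h.isGeneralizedDicyclic_right hq hq7 hq11 hq19 hq23 hq59
  have hm : Nat.card (GaloisField p a) + 1 = 2 * ((Nat.card (GaloisField p a) + 1) / 2) := by omega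
  have : NeZero ((Nat.card (GaloisField p a) + 1) / 2) := ⟨by omega⟩
  refine ⟨hdic₁.mem, hdic₂.mem, hdic₁.card, hdic₂.card, ?_, ?_, ?_⟩
  · ext g
    constructor
    · exact fun hg ↦ hinf g hg.1 (hA₂ hg.2)
    · rintro (rfl | rfl)
      exacts [one_mem _, ⟨hdic₁.mem, hdic₂.mem⟩]
  · rw [hm] at hdic₁
    exact hdic₁.nonempty_map_center_mulEquiv sl_neg_one_ne_one fun _ ↦ sl_mem_center_iff
  · rw [hm] at hdic₂
    exact hdic₂.nonempty_map_center_mulEquiv sl_neg_one_ne_one fun _ ↦ sl_mem_center_iff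
end

section
/- Let K = 𝔽_q((u)) with its u-adic valuation topology. If q = 5, there exist finite subgroups A₁, A₂ of SL₂(K), each isomorphic to SL₂(𝔽₃), with A₁ ∩ A₂ cyclic of order 4, such that the subgroup generated by A₁ ∪ A₂ is discrete and cocompact in SL₂(K). If q = 29, there exist finite subgroups A₁, A₂ of SL₂(K), each isomorphic to SL₂(𝔽₅), with A₁ ∩ A₂ cyclic of order 4, such that the subgroup generated by A₁ ∪ A₂ is discrete and cocompact in SL₂(K). -/
instance : Fact (Nat.Prime 5) := ⟨by norm_num⟩
instance : Fact (Nat.Prime 29) := ⟨by norm_num⟩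

/-- `SL₂` over a topological field carries the subspace topology induced from the
entrywise topology on `2 × 2` matrices. -/
noncomputable instance SL2.topologicalSpace (K : Type*) [Field K] [TopologicalSpace K] :
    TopologicalSpace (Matrix.SpecialLinearGroup (Fin 2) K) :=
  TopologicalSpace.induced
    (fun g => (↑g : Matrix (Fin 2) (Fin 2) K)) inferInstance

namespace SL2Lattice

open Topology WithZero LaurentSeries

section Field

variable {F : Type*} [Field F]

/-- The uniformizer of `F⸨X⸩`. -/
noncomputable abbrev unif (F : Type*) [Field F] : F⸨X⸩ := HahnSeries.single 1 1

lemma unif_ne_zero : unif F ≠ 0 := HahnSeries.single_ne_zero one_ne_zero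

lemma valuation_unif : Valued.v (unif F) = exp (-1 : ℤ) := valuation_single_zpow F 1

lemma valuation_C_le (x : F) : Valued.v (HahnSeries.C x : F⸨X⸩) ≤ 1 :=
  (val_le_one_iff_eq_coe F _).2 ⟨PowerSeries.C x, PowerSeries.coe_C x⟩

lemma valuation_C {x : F} (hx : x ≠ 0) : Valued.v (HahnSeries.C x : F⸨X⸩) = 1 := by
  refine le_antisymm (valuation_C_le x) ?_
  have h : Valued.v (HahnSeries.C x : F⸨X⸩) * Valued.v (HahnSeries.C x⁻¹ : F⸨X⸩) = 1 := by
    rw [← map_mul, ← map_mul, mul_inv_cancel₀ hx, map_one, map_one]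
  calc (1 : ℤᵐ⁰) = _ := h.symm
    _ ≤ Valued.v (HahnSeries.C x : F⸨X⸩) * 1 := by gcongr; exact valuation_C_le _
    _ = _ := mul_one _

lemma valuation_C_mul_le (x : F) (y : F⸨X⸩) :
    Valued.v (HahnSeries.C x * y) ≤ Valued.v y := by
  rw [map_mul]
  exact mul_le_of_le_one_left' (valuation_C_le x)

lemma valuation_C_mul {x : F} (hx : x ≠ 0) (y : F⸨X⸩) :
    Valued.v (HahnSeries.C x * y) = Valued.v y := by
  rw [map_mul, valuation_C hx, one_mul]

lemma valuation_le_exp_iff {x : F⸨X⸩} {n : ℤ} :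
    Valued.v x ≤ exp n ↔ ∃ p : PowerSeries F, x = unif F ^ (-n) * (p : F⸨X⸩) := by
  have h : Valued.v x ≤ exp n ↔ Valued.v (unif F ^ n * x) ≤ 1 := by
    rw [map_mul, map_zpow₀, valuation_unif, ← exp_zsmul, smul_neg, smul_eq_mul, mul_one, exp_neg]
    rw [inv_mul_le_iff₀ (by simp [zero_lt_iff]), mul_one]
  rw [h, val_le_one_iff_eq_coe]
  refine exists_congr fun p => ?_
  rw [_root_.zpow_neg, eq_inv_mul_iff_mul_eq₀ (zpow_ne_zero _ unif_ne_zero)]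
  exact eq_comm

lemma isCompact_integers [Finite F] : IsCompact {x : F⸨X⸩ | Valued.v x ≤ 1} := by
  let : TopologicalSpace F := ⊥
  have : DiscreteTopology F := ⟨rfl⟩
  have hcont : Continuous fun f : ℕ → F => ((PowerSeries.mk f : PowerSeries F) : F⸨X⸩) := by
    refine continuous_iff_continuousAt.2 fun f => ?_
    intro U hU
    obtain ⟨γ, hU₁⟩ := Valued.mem_nhds.mp hU
    obtain ⟨D, hD⟩ : ∃ D : ℕ, exp (-(D : ℤ)) <
        MonoidWithZeroHom.ValueGroup₀.embedding γ.1 := by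
      refine ⟨(1 - log (MonoidWithZeroHom.ValueGroup₀.embedding γ.1)).toNat, ?_⟩
      rw [← lt_log_iff_exp_lt (by simp)]
      have := Int.self_le_toNat (1 - log (MonoidWithZeroHom.ValueGroup₀.embedding γ.1))
      lia
    have hV : (⋂ n ∈ Finset.range D, {g : ℕ → F | g n = f n}) ∈ 𝓝 f := by
      rw [Filter.biInter_finset_mem]
      intro n _
      exact (continuous_apply (A := fun _ : ℕ => F) n).continuousAt.preimage_mem_nhds
        (mem_nhds_discrete.2 (show f n ∈ ({f n} : Set F) from rfl))
    refine Filter.mem_map.2 (Filter.mem_of_superset hV fun g hg => hU₁ ?_)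
    rw [Set.mem_ofPred_eq, Valuation.restrict_lt_iff_lt_embedding]
    refine lt_of_le_of_lt ?_ hD
    rw [← PowerSeries.coe_sub]
    refine (intValuation_le_iff_coeff_lt_eq_zero F _).2 fun n hn => ?_
    have := Set.mem_iInter₂.1 hg n (Finset.mem_range.2 hn)
    simpa [sub_eq_zero] using this
  convert isCompact_range hcont
  ext x
  rw [Set.mem_ofPred_eq, val_le_one_iff_eq_coe]
  constructor
  · rintro ⟨p, rfl⟩
    exact ⟨fun n => PowerSeries.coeff n p, congrArg (HahnSeries.ofPowerSeries ℤ F) (by ext; simp)⟩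
  · rintro ⟨f, rfl⟩
    exact ⟨_, rfl⟩

end Field

section Topology

variable {K : Type*} [Field K] [TopologicalSpace K]

lemma isInducing_coe :
    IsInducing (fun g : Matrix.SpecialLinearGroup (Fin 2) K => (g : Matrix (Fin 2) (Fin 2) K)) := ⟨rfl⟩

lemma isCompact_setOf_entries_mem [IsTopologicalRing K] [T1Space K] {S : Set K}
    (hS : IsCompact S) :
    IsCompact {g : Matrix.SpecialLinearGroup (Fin 2) K | ∀ i j, g i j ∈ S} := by
  rw [isInducing_coe.isCompact_iff]
  have hM : IsCompact {M : Matrix (Fin 2) (Fin 2) K | ∀ i j, M i j ∈ S} := by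
    have := isCompact_univ_pi (fun _ : Fin 2 => isCompact_univ_pi (fun _ : Fin 2 => hS))
    have hs : {M : Matrix (Fin 2) (Fin 2) K | ∀ i j, M i j ∈ S} =
        Set.univ.pi fun _ => Set.univ.pi fun _ => S := by
      ext M
      exact ⟨fun h i _ j _ => h i j, fun h i j => h i trivial j trivial⟩
    rw [hs]
    exact this
  have hdet : IsClosed {M : Matrix (Fin 2) (Fin 2) K | M.det = 1} :=
    isClosed_singleton.preimage (Continuous.matrix_det continuous_id)
  convert hM.inter_right hdet
  ext M
  constructor
  · rintro ⟨g, hg, rfl⟩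
    exact ⟨hg, g.det_coe⟩
  · rintro ⟨hM, hd⟩
    exact ⟨⟨M, hd⟩, hM, rfl⟩

lemma isOpen_setOf_entries_mem {S : Set K} (hS : IsOpen S) :
    IsOpen {g : Matrix.SpecialLinearGroup (Fin 2) K | ∀ i j, g i j ∈ S} := by
  have hM : IsOpen {M : Matrix (Fin 2) (Fin 2) K | ∀ i j, M i j ∈ S} := by
    simp only [Set.ofPred_forall]
    exact isOpen_iInter_of_finite fun i => isOpen_iInter_of_finite fun j =>
      hS.preimage (continuous_id.matrix_elem i j)
  exact hM.preimage isInducing_coe.continuous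

/-- A subgroup meeting an open set containing `1` in a finite set is discrete. -/
lemma discreteTopology_of_finite_inter [IsTopologicalRing K] [T1Space K]
    {Γ : Subgroup (Matrix.SpecialLinearGroup (Fin 2) K)} {U : Set (Matrix.SpecialLinearGroup (Fin 2) K)}
    (hU : IsOpen U) (h1 : 1 ∈ U) (hfin : ((Γ : Set _) ∩ U).Finite) : DiscreteTopology Γ := by
  have : ContinuousMul (Matrix.SpecialLinearGroup (Fin 2) K) :=
    continuousMul_induced
      ({ toFun := fun g => (g : Matrix (Fin 2) (Fin 2) K)
         map_one' := Matrix.SpecialLinearGroup.coe_one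
         map_mul' := Matrix.SpecialLinearGroup.coe_mul } :
        Matrix.SpecialLinearGroup (Fin 2) K →* Matrix (Fin 2) (Fin 2) K)
  have : T1Space (Matrix.SpecialLinearGroup (Fin 2) K) :=
    t1Space_of_injective_of_continuous Subtype.val_injective isInducing_coe.continuous
  have : ContinuousMul Γ := Γ.toSubmonoid.continuousMul
  refine discreteTopology_of_isOpen_singleton_one ?_
  have hV : IsOpen (U \ (((Γ : Set _) ∩ U) \ {1})) :=
    hU.sdiff (hfin.subset Set.sdiff_subset).isClosed
  convert hV.preimage (continuous_subtype_val (p := fun g => g ∈ Γ))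
  ext γ
  simp only [Set.mem_singleton_iff, Set.mem_preimage, Set.mem_sdiff, Set.mem_inter_iff,
    SetLike.mem_coe, SetLike.coe_mem, true_and, OneMemClass.coe_eq_one]
  constructor
  · rintro rfl
    simpa using h1
  · tauto

end Topology

/-- `A ≤ SL₂(F)` acts on `ℙ¹(F)` so that both coordinate points have transitive orbits
and stabilizer `C`. -/
structure IsEdgePair {F : Type*} [Field F]
    (A C : Subgroup (Matrix.SpecialLinearGroup (Fin 2) F)) : Prop where
  le : C ≤ A
  lower_eq_zero_iff : ∀ g ∈ A, g 1 0 = 0 ↔ g ∈ C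
  upper_eq_zero_iff : ∀ g ∈ A, g 0 1 = 0 ↔ g ∈ C
  exists_col : ∀ (j : Fin 2) (x y : F), ∃ g ∈ A, x * g 0 j + y * g 1 j = 0

section Field

variable {F : Type*} [Field F]

/-- The inclusion of `SL₂(F)` into `SL₂(F⸨X⸩)` as constant matrices. -/
noncomputable def const (F : Type*) [Field F] :
    Matrix.SpecialLinearGroup (Fin 2) F →* Matrix.SpecialLinearGroup (Fin 2) F⸨X⸩ :=
  Matrix.SpecialLinearGroup.map HahnSeries.C

@[simp] lemma const_apply (g : Matrix.SpecialLinearGroup (Fin 2) F) (i j : Fin 2) :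
    const F g i j = HahnSeries.C (g i j) := rfl

lemma const_injective : Function.Injective (const F) := by
  intro g h hgh
  refine Matrix.SpecialLinearGroup.ext _ _ fun i j => ?_
  have := congrArg (fun m : Matrix.SpecialLinearGroup (Fin 2) F⸨X⸩ => m i j) hgh
  exact HahnSeries.C_injective (Γ := ℤ) this

lemma two_by_two_mul {R : Type*} [CommRing R] (g h : Matrix.SpecialLinearGroup (Fin 2) R)
    (i j : Fin 2) : (g * h) i j = g i 0 * h 0 j + g i 1 * h 1 j := by
  rw [Matrix.SpecialLinearGroup.coe_mul, Matrix.mul_apply, Fin.sum_univ_two]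

/-- The conjugate by `diag(u, 1)` of the inclusion of `SL₂(F)` into `SL₂(F⸨X⸩)`. -/
noncomputable def twist (F : Type*) [Field F] :
    Matrix.SpecialLinearGroup (Fin 2) F →* Matrix.SpecialLinearGroup (Fin 2) F⸨X⸩ where
  toFun g := ⟨!![HahnSeries.C (g 0 0), unif F * HahnSeries.C (g 0 1);
      (unif F)⁻¹ * HahnSeries.C (g 1 0), HahnSeries.C (g 1 1)], by
    have h := congrArg (HahnSeries.C : F →+* F⸨X⸩) g.det_coe
    rw [Matrix.det_fin_two, map_sub, map_mul, map_mul, map_one] at h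
    rw [Matrix.det_fin_two_of, ← h, mul_mul_mul_comm, mul_inv_cancel₀ unif_ne_zero, one_mul]⟩
  map_one' := by
    refine Matrix.SpecialLinearGroup.ext _ _ fun i j => ?_
    fin_cases i <;> fin_cases j <;> simp
  map_mul' g h := by
    have hu : unif F ≠ 0 := unif_ne_zero
    refine Matrix.SpecialLinearGroup.ext _ _ fun i j => ?_
    refine Eq.trans ?_ (two_by_two_mul _ _ i j).symm
    fin_cases i <;> fin_cases j
    · change HahnSeries.C ((g * h) 0 0) = HahnSeries.C (g 0 0) * HahnSeries.C (h 0 0) +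
        (unif F * HahnSeries.C (g 0 1)) * ((unif F)⁻¹ * HahnSeries.C (h 1 0))
      rw [two_by_two_mul, map_add, map_mul, map_mul]
      field_simp
    · change unif F * HahnSeries.C ((g * h) 0 1) =
        HahnSeries.C (g 0 0) * (unif F * HahnSeries.C (h 0 1)) +
        (unif F * HahnSeries.C (g 0 1)) * HahnSeries.C (h 1 1)
      rw [two_by_two_mul, map_add, map_mul, map_mul]
      ring
    · change (unif F)⁻¹ * HahnSeries.C ((g * h) 1 0) =
        (unif F)⁻¹ * HahnSeries.C (g 1 0) * HahnSeries.C (h 0 0) +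
        HahnSeries.C (g 1 1) * ((unif F)⁻¹ * HahnSeries.C (h 1 0))
      rw [two_by_two_mul, map_add, map_mul, map_mul]
      ring
    · change HahnSeries.C ((g * h) 1 1) =
        (unif F)⁻¹ * HahnSeries.C (g 1 0) * (unif F * HahnSeries.C (h 0 1)) +
        HahnSeries.C (g 1 1) * HahnSeries.C (h 1 1)
      rw [two_by_two_mul, map_add, map_mul, map_mul]
      field_simp

lemma twist_apply (g : Matrix.SpecialLinearGroup (Fin 2) F) :
    twist F g 0 0 = HahnSeries.C (g 0 0) ∧ twist F g 0 1 = unif F * HahnSeries.C (g 0 1) ∧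
    twist F g 1 0 = (unif F)⁻¹ * HahnSeries.C (g 1 0) ∧
    twist F g 1 1 = HahnSeries.C (g 1 1) := ⟨rfl, rfl, rfl, rfl⟩

lemma twist_injective : Function.Injective (twist F) := by
  intro g h hgh
  have H := fun i j => congrArg (fun m : Matrix.SpecialLinearGroup (Fin 2) F⸨X⸩ => m i j) hgh
  refine Matrix.SpecialLinearGroup.ext _ _ fun i j => ?_
  refine HahnSeries.C_injective (Γ := ℤ) ?_
  fin_cases i <;> fin_cases j
  · exact H 0 0
  · exact mul_left_cancel₀ unif_ne_zero (H 0 1)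
  · exact mul_left_cancel₀ (inv_ne_zero unif_ne_zero) (H 1 0)
  · exact H 1 1

lemma twist_eq_const {g : Matrix.SpecialLinearGroup (Fin 2) F} (h₁ : g 0 1 = 0)
    (h₂ : g 1 0 = 0) : twist F g = const F g := by
  refine Matrix.SpecialLinearGroup.ext _ _ fun i j => ?_
  fin_cases i <;> fin_cases j
  · rfl
  · change unif F * HahnSeries.C (g 0 1) = HahnSeries.C (g 0 1)
    simp [h₁]
  · change (unif F)⁻¹ * HahnSeries.C (g 1 0) = HahnSeries.C (g 1 0)
    simp [h₂]
  · rfl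

lemma upper_eq_zero_of_twist_eq_const {g h : Matrix.SpecialLinearGroup (Fin 2) F}
    (hgh : twist F g = const F h) : g 0 1 = 0 := by
  have h₁ : unif F * HahnSeries.C (g 0 1) = HahnSeries.C (h 0 1) :=
    congrArg (fun m : Matrix.SpecialLinearGroup (Fin 2) F⸨X⸩ => m 0 1) hgh
  have := congrArg (fun f : F⸨X⸩ => f.coeff 1) h₁
  simpa [HahnSeries.C_apply] using this

variable {A C : Subgroup (Matrix.SpecialLinearGroup (Fin 2) F)}

lemma IsEdgePair.twist_eq_const (h : IsEdgePair A C) {g} (hg : g ∈ C) :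
    twist F g = const F g :=
  SL2Lattice.twist_eq_const ((h.upper_eq_zero_iff g (h.le hg)).2 hg)
    ((h.lower_eq_zero_iff g (h.le hg)).2 hg)

lemma IsEdgePair.map_inf_map (h : IsEdgePair A C) :
    A.map (const F) ⊓ A.map (twist F) = C.map (const F) := by
  ext g
  constructor
  · rintro ⟨⟨a, ha, rfl⟩, b, hb, hab⟩
    have hbC : b ∈ C := (h.upper_eq_zero_iff b hb).1 (upper_eq_zero_of_twist_eq_const hab)
    rw [← hab, h.twist_eq_const hbC]
    exact ⟨b, hbC, rfl⟩
  · rintro ⟨c, hc, rfl⟩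
    exact ⟨⟨c, h.le hc, rfl⟩, c, h.le hc, h.twist_eq_const hc⟩

/-- The group generated by the two embedded copies of `A`. -/
noncomputable abbrev lattice (A : Subgroup (Matrix.SpecialLinearGroup (Fin 2) F)) :
    Subgroup (Matrix.SpecialLinearGroup (Fin 2) F⸨X⸩) :=
  Subgroup.closure (↑(A.map (const F)) ∪ ↑(A.map (twist F)))

/-- Alternating words in the two copies of `A` modulo `C`; the flag says whether the leftmost
letter is a twisted one. -/
inductive IsReduced (A C : Subgroup (Matrix.SpecialLinearGroup (Fin 2) F)) :
    Bool → Matrix.SpecialLinearGroup (Fin 2) F⸨X⸩ → Prop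
  | const {a} : a ∈ A → IsReduced A C false (const F a)
  | twist_mul {b g} : b ∈ A → b ∉ C → IsReduced A C false g → IsReduced A C true (twist F b * g)
  | const_mul {a g} : a ∈ A → a ∉ C → IsReduced A C true g → IsReduced A C false (const F a * g)

lemma IsEdgePair.isReduced_mul (h : IsEdgePair A C) {c g i} (hc : c ∈ C)
    (hg : IsReduced A C i g) : IsReduced A C i (const F c * g) := by
  cases hg with
  | const ha =>
    rw [← map_mul]
    exact .const (mul_mem (h.le hc) ha)
  | twist_mul hb hbC hg =>
    rw [← h.twist_eq_const hc, ← mul_assoc, ← map_mul]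
    exact .twist_mul (mul_mem (h.le hc) hb) (fun h' => hbC ((C.mul_mem_cancel_left hc).1 h')) hg
  | const_mul hb hbC hg =>
    rw [← mul_assoc, ← map_mul]
    exact .const_mul (mul_mem (h.le hc) hb) (fun h' => hbC ((C.mul_mem_cancel_left hc).1 h')) hg

lemma IsEdgePair.isReduced_const_mul (h : IsEdgePair A C) {a g i} (ha : a ∈ A)
    (hg : IsReduced A C i g) : ∃ j, IsReduced A C j (const F a * g) := by
  cases hg with
  | const hb => exact ⟨_, by rw [← map_mul]; exact .const (mul_mem ha hb)⟩
  | twist_mul hb hbC hg =>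
    by_cases haC : a ∈ C
    · exact ⟨_, h.isReduced_mul haC (.twist_mul hb hbC hg)⟩
    · exact ⟨_, .const_mul ha haC (.twist_mul hb hbC hg)⟩
  | @const_mul b g hb hbC hg =>
    rw [← mul_assoc, ← map_mul]
    by_cases haC : a * b ∈ C
    · exact ⟨_, h.isReduced_mul haC hg⟩
    · exact ⟨_, .const_mul (mul_mem ha hb) haC hg⟩

lemma IsEdgePair.isReduced_twist_mul (h : IsEdgePair A C) {a g i} (ha : a ∈ A)
    (hg : IsReduced A C i g) : ∃ j, IsReduced A C j (twist F a * g) := by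
  cases i with
  | false =>
    by_cases haC : a ∈ C
    · rw [h.twist_eq_const haC]
      exact ⟨_, h.isReduced_mul haC hg⟩
    · exact ⟨_, .twist_mul ha haC hg⟩
  | true =>
    obtain _ | ⟨hb, hbC, hg⟩ := hg
    rename_i b g
    rw [← mul_assoc, ← map_mul]
    by_cases haC : a * b ∈ C
    · rw [h.twist_eq_const haC]
      exact ⟨_, h.isReduced_mul haC hg⟩
    · exact ⟨_, .twist_mul (mul_mem ha hb) haC hg⟩

lemma IsEdgePair.exists_isReduced (h : IsEdgePair A C) {g} (hg : g ∈ lattice A) :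
    ∃ i, IsReduced A C i g := by
  induction hg using Subgroup.closure_induction_left with
  | one => exact ⟨_, by rw [← map_one (const F)]; exact .const (one_mem A)⟩
  | mul_left x hx y hy ih =>
    obtain ⟨i, ih⟩ := ih
    rcases hx with ⟨a, ha, rfl⟩ | ⟨a, ha, rfl⟩
    · exact h.isReduced_const_mul ha ih
    · exact h.isReduced_twist_mul ha ih
  | inv_mul_cancel x hx y hy ih =>
    obtain ⟨i, ih⟩ := ih
    rcases hx with ⟨a, ha, rfl⟩ | ⟨a, ha, rfl⟩
    · rw [← map_inv]
      exact h.isReduced_const_mul (inv_mem ha) ih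
    · rw [← map_inv]
      exact h.isReduced_twist_mul (inv_mem ha) ih

/-- The top row of `g` dominates. -/
def TopDominant (g : Matrix.SpecialLinearGroup (Fin 2) F⸨X⸩) : Prop :=
  ∃ k, 1 ≤ Valued.v (g 0 k) ∧ ∀ i j, Valued.v (g i j) ≤ Valued.v (g 0 k)

/-- The bottom row of `g` strictly dominates. -/
def BotDominant (g : Matrix.SpecialLinearGroup (Fin 2) F⸨X⸩) : Prop :=
  ∃ k, 1 < Valued.v (g 1 k) ∧ (∀ j, Valued.v (g 1 j) ≤ Valued.v (g 1 k)) ∧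
    ∀ j, Valued.v (g 0 j) < Valued.v (g 1 k)

lemma exists_ne_zero_row (g : Matrix.SpecialLinearGroup (Fin 2) F) (i : Fin 2) :
    ∃ k, g i k ≠ 0 := by
  by_contra! h
  exact one_ne_zero (g.det_coe.symm.trans (Matrix.det_eq_zero_of_row_eq_zero i h))

lemma topDominant_const (a : Matrix.SpecialLinearGroup (Fin 2) F) : TopDominant (const F a) := by
  obtain ⟨k, hk⟩ := exists_ne_zero_row a 0
  refine ⟨k, ?_⟩
  simp only [const_apply, valuation_C hk]
  exact ⟨le_rfl, fun i j => valuation_C_le _⟩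

lemma BotDominant.const_mul {g : Matrix.SpecialLinearGroup (Fin 2) F⸨X⸩} (hg : BotDominant g)
    {a : Matrix.SpecialLinearGroup (Fin 2) F} (ha : a 0 1 ≠ 0) :
    ∃ k, 1 < Valued.v ((const F a * g) 0 k) ∧
      ∀ i j, Valued.v ((const F a * g) i j) ≤ Valued.v ((const F a * g) 0 k) := by
  obtain ⟨k, h1, h2, h3⟩ := hg
  have hk : Valued.v ((const F a * g) 0 k) = Valued.v (g 1 k) := by
    rw [two_by_two_mul, const_apply, const_apply, Valuation.map_add_eq_of_lt_right,
      valuation_C_mul ha]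
    rw [valuation_C_mul ha]
    exact (valuation_C_mul_le _ _).trans_lt (h3 k)
  refine ⟨k, hk ▸ h1, fun i j => ?_⟩
  rw [hk, two_by_two_mul]
  exact Valuation.map_add_le _ ((valuation_C_mul_le _ _).trans (h3 j).le)
    ((valuation_C_mul_le _ _).trans (h2 j))

lemma TopDominant.twist_mul {g : Matrix.SpecialLinearGroup (Fin 2) F⸨X⸩} (hg : TopDominant g)
    {b : Matrix.SpecialLinearGroup (Fin 2) F} (hb : b 1 0 ≠ 0) : BotDominant (twist F b * g) := by
  obtain ⟨k, h1, h2⟩ := hg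
  obtain ⟨e1, e2, e3, e4⟩ := twist_apply b
  have hpos : (0 : ℤᵐ⁰) < Valued.v (g 0 k) := zero_lt_one.trans_le h1
  have hu : Valued.v (unif F)⁻¹ = exp (1 : ℤ) := by rw [map_inv₀, valuation_unif, exp_neg, inv_inv]
  have hlt : Valued.v (g 0 k) < exp (1 : ℤ) * Valued.v (g 0 k) :=
    lt_mul_of_one_lt_left hpos (by rw [← exp_zero, exp_lt_exp]; norm_num)
  have hk : Valued.v ((twist F b * g) 1 k) = exp (1 : ℤ) * Valued.v (g 0 k) := by
    rw [two_by_two_mul, e3, e4]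
    have : Valued.v ((unif F)⁻¹ * HahnSeries.C (b 1 0) * g 0 k) =
        exp (1 : ℤ) * Valued.v (g 0 k) := by
      rw [mul_assoc, map_mul, hu, valuation_C_mul hb]
    rw [Valuation.map_add_eq_of_lt_left, this]
    rw [this]
    exact ((valuation_C_mul_le _ _).trans (h2 1 k)).trans_lt hlt
  refine ⟨k, hk ▸ h1.trans_lt hlt, fun j => ?_, fun j => ?_⟩
  · rw [hk, two_by_two_mul, e3, e4]
    refine Valuation.map_add_le _ ?_ (((valuation_C_mul_le _ _).trans (h2 1 j)).trans hlt.le)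
    rw [mul_assoc, map_mul, hu]
    gcongr
    exact (valuation_C_mul_le _ _).trans (h2 0 j)
  · rw [hk, two_by_two_mul, e1, e2]
    refine lt_of_le_of_lt (Valuation.map_add_le _ ((valuation_C_mul_le _ _).trans (h2 0 j)) ?_) hlt
    rw [mul_assoc, map_mul, valuation_unif]
    refine (mul_le_of_le_one_left' ?_).trans ((valuation_C_mul_le _ _).trans (h2 1 j))
    rw [← exp_zero, exp_le_exp]
    norm_num

lemma IsEdgePair.dominant_of_isReduced (h : IsEdgePair A C) {i g} (hg : IsReduced A C i g) :
    (i = false → TopDominant g ∧ (g ∈ A.map (const F) ∨ ∃ k, 1 < Valued.v (g 0 k))) ∧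
    (i = true → BotDominant g) := by
  induction hg with
  | const ha => exact ⟨fun _ => ⟨topDominant_const _, .inl ⟨_, ha, rfl⟩⟩, by simp⟩
  | twist_mul hb hbC hg ih =>
    exact ⟨by simp, fun _ =>
      (ih.1 rfl).1.twist_mul (fun h0 => hbC ((h.lower_eq_zero_iff _ hb).1 h0))⟩
  | const_mul ha haC hg ih =>
    obtain ⟨k, h1, h2⟩ :=
      (ih.2 rfl).const_mul (fun h0 => haC ((h.upper_eq_zero_iff _ ha).1 h0))
    exact ⟨fun _ => ⟨⟨k, h1.le, h2⟩, .inr ⟨k, h1⟩⟩, by simp⟩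

lemma IsEdgePair.mem_map_of_integral (h : IsEdgePair A C) {g} (hg : g ∈ lattice A)
    (hint : ∀ i j, Valued.v (g i j) ≤ 1) : g ∈ A.map (const F) := by
  obtain ⟨i, hi⟩ := h.exists_isReduced hg
  cases i with
  | false =>
    refine ((h.dominant_of_isReduced hi).1 rfl).2.resolve_right ?_
    rintro ⟨k, hk⟩
    exact hk.not_ge (hint 0 k)
  | true =>
    obtain ⟨k, hk, -⟩ := (h.dominant_of_isReduced hi).2 rfl
    exact absurd (hint 1 k) hk.not_ge

lemma isOpen_integers : IsOpen {x : F⸨X⸩ | Valued.v x ≤ 1} := Valued.isOpen_integer F⸨X⸩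

lemma IsEdgePair.discreteTopology_lattice [Finite A] (h : IsEdgePair A C) :
    DiscreteTopology (lattice A) := by
  refine discreteTopology_of_finite_inter (isOpen_setOf_entries_mem isOpen_integers) ?_
    (Set.Finite.subset (s := (A.map (const F) : Set _)) ?_ ?_)
  · rw [← map_one (const F)]
    exact fun i j => valuation_C_le _
  · rw [Subgroup.coe_map]
    exact (Set.toFinite (A : Set (Matrix.SpecialLinearGroup (Fin 2) F))).image _
  · rintro g ⟨hg, hint⟩
    exact h.mem_map_of_integral hg hint

end Field

section Field

variable {F : Type*} [Field F] {A C : Subgroup (Matrix.SpecialLinearGroup (Fin 2) F)}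

lemma exists_row_of_singular {a b c d : F} (h : a * d = b * c) :
    ∃ x y : F, ∀ p r : F, x * p + y * r = 0 → a * p + b * r = 0 ∧ c * p + d * r = 0 := by
  by_cases ha : a = 0
  · by_cases hb : b = 0
    · exact ⟨c, d, fun p r hpr => ⟨by simp [ha, hb], hpr⟩⟩
    · refine ⟨a, b, fun p r hpr => ⟨hpr, mul_left_cancel₀ hb ?_⟩⟩
      linear_combination d * hpr - p * h
  · refine ⟨a, b, fun p r hpr => ⟨hpr, mul_left_cancel₀ ha ?_⟩⟩
    linear_combination c * hpr + r * h

open PowerSeries in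
lemma IsEdgePair.exists_dvd (h : IsEdgePair A C) (j : Fin 2) {p₀ p₁ r₀ r₁ : F⟦X⟧}
    (hX : X ∣ p₀ * r₁ - p₁ * r₀) :
    ∃ a ∈ A, (X ∣ p₀ * PowerSeries.C (a 0 j) + p₁ * PowerSeries.C (a 1 j)) ∧
      (X ∣ r₀ * PowerSeries.C (a 0 j) + r₁ * PowerSeries.C (a 1 j)) := by
  rw [X_dvd_iff, map_sub, map_mul, map_mul, sub_eq_zero] at hX
  obtain ⟨x, y, hxy⟩ := exists_row_of_singular hX
  obtain ⟨a, ha, h0⟩ := h.exists_col j x y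
  refine ⟨a, ha, ?_⟩
  simpa [X_dvd_iff] using hxy _ _ h0

lemma coe_X_eq : ((PowerSeries.X : PowerSeries F) : F⸨X⸩) = unif F := PowerSeries.coe_X

lemma X_dvd_of_coe_eq {p : PowerSeries F} {n : ℕ} (hn : 0 < n)
    (hp : (p : F⸨X⸩) = unif F ^ n) : PowerSeries.X ∣ p := by
  have : p = PowerSeries.X ^ n := by
    apply HahnSeries.ofPowerSeries_injective (Γ := ℤ)
    rw [hp, map_pow, coe_X_eq]
  rw [this]
  exact dvd_pow_self _ hn.ne'

lemma valuation_le_of_X_dvd {p : PowerSeries F} (hp : PowerSeries.X ∣ p) (n : ℤ) :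
    Valued.v (unif F ^ (-(n + 1)) * (p : F⸨X⸩)) ≤ exp n := by
  obtain ⟨s, rfl⟩ := hp
  rw [valuation_le_exp_iff]
  refine ⟨s, ?_⟩
  rw [map_mul, coe_X_eq, ← mul_assoc, ← zpow_add_one₀ unif_ne_zero]
  congr 2
  ring

lemma IsEdgePair.exists_const_mul (h : IsEdgePair A C)
    {g : Matrix.SpecialLinearGroup (Fin 2) F⸨X⸩} {n : ℕ}
    (hg : ∀ i j, Valued.v (g i j) ≤ exp ((n : ℤ) + 1)) :
    ∃ a ∈ A, ∀ i, Valued.v ((g * const F a) i 0) ≤ exp ((n : ℤ) + 1) ∧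
      Valued.v ((g * const F a) i 1) ≤ exp (n : ℤ) := by
  choose p hp using fun i j => valuation_le_exp_iff.1 (hg i j)
  have hu : unif F ≠ 0 := unif_ne_zero
  have hdet : PowerSeries.X ∣ p 0 0 * p 1 1 - p 0 1 * p 1 0 := by
    refine X_dvd_of_coe_eq (n := 2 * (n + 1)) (by positivity) ?_
    have h1 := g.det_coe
    rw [Matrix.det_fin_two, hp, hp, hp, hp] at h1
    rw [map_sub, map_mul, map_mul]
    rw [zpow_neg, ← Nat.cast_add_one, zpow_natCast] at h1
    field_simp at h1
    rw [h1]
    ring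
  obtain ⟨a, ha, h0, h1⟩ := h.exists_dvd 1 hdet
  refine ⟨a, ha, fun i => ⟨?_, ?_⟩⟩
  · rw [two_by_two_mul, mul_comm, mul_comm (g i 1)]
    exact Valuation.map_add_le _ ((valuation_C_mul_le _ _).trans (hg i 0))
      ((valuation_C_mul_le _ _).trans (hg i 1))
  · have hi : PowerSeries.X ∣
        p i 0 * PowerSeries.C (a 0 1) + p i 1 * PowerSeries.C (a 1 1) := by
      fin_cases i
      · exact h0
      · exact h1
    convert valuation_le_of_X_dvd hi n using 2
    rw [two_by_two_mul, hp i 0, hp i 1, map_add, map_mul, map_mul, PowerSeries.coe_C,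
      PowerSeries.coe_C, const_apply, const_apply]
    ring

lemma IsEdgePair.exists_twist_mul (h : IsEdgePair A C)
    {g : Matrix.SpecialLinearGroup (Fin 2) F⸨X⸩} {n : ℕ}
    (hg : ∀ i, Valued.v (g i 0) ≤ exp ((n : ℤ) + 1) ∧ Valued.v (g i 1) ≤ exp (n : ℤ)) :
    ∃ a ∈ A, ∀ i j, Valued.v ((g * twist F a) i j) ≤ exp (n : ℤ) := by
  choose p hp using fun i => valuation_le_exp_iff.1 (hg i).1
  choose r hr using fun i => valuation_le_exp_iff.1 (hg i).2
  have hu : unif F ≠ 0 := unif_ne_zero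
  have hdet : PowerSeries.X ∣ p 0 * r 1 - r 0 * p 1 := by
    refine X_dvd_of_coe_eq (n := 2 * n + 1) (by positivity) ?_
    have h1 := g.det_coe
    rw [Matrix.det_fin_two, hp, hr, hp, hr] at h1
    rw [map_sub, map_mul, map_mul]
    rw [zpow_neg, zpow_neg, ← Nat.cast_add_one, zpow_natCast, zpow_natCast] at h1
    field_simp at h1
    rw [h1]
    ring
  obtain ⟨a, ha, h0, h1⟩ := h.exists_dvd 0 hdet
  obtain ⟨e1, e2, e3, e4⟩ := twist_apply a
  refine ⟨a, ha, fun i j => ?_⟩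
  rw [two_by_two_mul]
  fin_cases j
  · have hi : PowerSeries.X ∣
        p i * PowerSeries.C (a 0 0) + r i * PowerSeries.C (a 1 0) := by
      fin_cases i
      · exact h0
      · exact h1
    convert valuation_le_of_X_dvd hi n using 2
    change g i 0 * twist F a 0 0 + g i 1 * twist F a 1 0 = _
    rw [e1, e3, hp i, hr i, map_add, map_mul, map_mul, PowerSeries.coe_C,
      PowerSeries.coe_C, neg_add, zpow_add₀ hu, zpow_neg_one]
    ring
  · change Valued.v (g i 0 * twist F a 0 1 + g i 1 * twist F a 1 1) ≤ _
    rw [e2, e4]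
    refine Valuation.map_add_le _ ?_ ?_
    · rw [mul_left_comm, mul_comm (g i 0), map_mul, valuation_unif]
      calc exp (-1 : ℤ) * Valued.v (HahnSeries.C (a 0 1) * g i 0)
          ≤ exp (-1 : ℤ) * exp ((n : ℤ) + 1) := by
            gcongr
            exact (valuation_C_mul_le _ _).trans (hg i).1
        _ = exp (n : ℤ) := by
            rw [← exp_add]
            congr 1
            ring
    · rw [mul_comm]
      exact (valuation_C_mul_le _ _).trans (hg i).2

lemma IsEdgePair.exists_mul_integral_of_le (h : IsEdgePair A C) (n : ℕ) :
    ∀ g : Matrix.SpecialLinearGroup (Fin 2) F⸨X⸩, (∀ i j, Valued.v (g i j) ≤ exp (n : ℤ)) →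
      ∃ γ ∈ lattice A, ∀ i j, Valued.v ((g * γ) i j) ≤ 1 := by
  induction n with
  | zero => exact fun g hg => ⟨1, one_mem _, by simpa using hg⟩
  | succ n ih =>
    intro g hg
    obtain ⟨a, ha, hga⟩ := h.exists_const_mul (n := n) (by exact_mod_cast hg)
    obtain ⟨b, hb, hgb⟩ := h.exists_twist_mul hga
    obtain ⟨γ, hγ, hint⟩ := ih _ hgb
    refine ⟨const F a * (twist F b * γ), mul_mem (Subgroup.subset_closure (.inl ⟨a, ha, rfl⟩))
      (mul_mem (Subgroup.subset_closure (.inr ⟨b, hb, rfl⟩)) hγ), ?_⟩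
    simpa only [mul_assoc] using hint

lemma exists_le_exp (x : F⸨X⸩) : ∃ n : ℕ, Valued.v x ≤ exp (n : ℤ) := by
  refine ⟨(log (Valued.v x)).toNat, ?_⟩
  exact le_exp_of_log_le (Int.self_le_toNat _)

lemma IsEdgePair.exists_mul_integral (h : IsEdgePair A C)
    (g : Matrix.SpecialLinearGroup (Fin 2) F⸨X⸩) :
    ∃ γ ∈ lattice A, ∀ i j, Valued.v ((g * γ) i j) ≤ 1 := by
  choose n hn using fun i j => exists_le_exp (g i j)
  refine h.exists_mul_integral_of_le (∑ i, ∑ j, n i j) g fun i j => (hn i j).trans ?_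
  rw [exp_le_exp, Nat.cast_le]
  exact (Finset.single_le_sum (f := fun j => n i j) (fun _ _ => Nat.zero_le _)
    (Finset.mem_univ j)).trans (Finset.single_le_sum (f := fun i => ∑ j, n i j)
    (fun _ _ => Nat.zero_le _) (Finset.mem_univ i))

lemma IsEdgePair.compactSpace_quotient [Finite F] (h : IsEdgePair A C) :
    CompactSpace (Matrix.SpecialLinearGroup (Fin 2) F⸨X⸩ ⧸ lattice A) := by
  have hK := isCompact_setOf_entries_mem (isCompact_integers (F := F))
  refine ⟨?_⟩
  convert hK.image (f := QuotientGroup.mk (s := lattice A)) continuous_quotient_mk'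
  refine (Set.eq_univ_of_forall fun x => ?_).symm
  obtain ⟨g, rfl⟩ := QuotientGroup.mk_surjective x
  obtain ⟨γ, hγ, hint⟩ := h.exists_mul_integral g
  exact ⟨g * γ, hint, QuotientGroup.mk_mul_of_mem g hγ⟩

/-- An edge-transitive finite subgroup of `SL₂(F)` gives an amalgam that is a cocompact lattice
in `SL₂(F⸨X⸩)`. -/
theorem IsEdgePair.exists_lattice [Finite F] {G : Type*} [Group G] (h : IsEdgePair A C)
    (e : A ≃* G) [IsCyclic C] {n : ℕ} (hC : Nat.card C = n) :
    ∃ A₁ A₂ : Subgroup (Matrix.SpecialLinearGroup (Fin 2) F⸨X⸩),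
      Finite A₁ ∧ Finite A₂ ∧ Nonempty (A₁ ≃* G) ∧ Nonempty (A₂ ≃* G) ∧
      IsCyclic ↥(A₁ ⊓ A₂) ∧ Nat.card ↥(A₁ ⊓ A₂) = n ∧
      DiscreteTopology (Subgroup.closure ((↑A₁ ∪ ↑A₂) :
        Set (Matrix.SpecialLinearGroup (Fin 2) F⸨X⸩))) ∧
      CompactSpace (Matrix.SpecialLinearGroup (Fin 2) F⸨X⸩ ⧸
        Subgroup.closure ((↑A₁ ∪ ↑A₂) : Set (Matrix.SpecialLinearGroup (Fin 2) F⸨X⸩))) := by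
  have e₁ := A.equivMapOfInjective (const F) const_injective
  have e₂ := A.equivMapOfInjective (twist F) twist_injective
  have e₀ := C.equivMapOfInjective (const F) const_injective
  refine ⟨A.map (const F), A.map (twist F), .of_equiv _ e₁.toEquiv, .of_equiv _ e₂.toEquiv,
    ⟨e₁.symm.trans e⟩, ⟨e₂.symm.trans e⟩, ?_, ?_, h.discreteTopology_lattice,
    h.compactSpace_quotient⟩
  · rw [h.map_inf_map]
    exact isCyclic_of_surjective e₀ e₀.surjective
  · rw [h.map_inf_map, ← hC]
    exact (Nat.card_congr e₀.toEquiv).symm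

end Field

section Elementary

variable {R : Type*} [CommRing R]

/-- Upper elementary matrix. -/
def upper (x : R) : Matrix.SpecialLinearGroup (Fin 2) R := ⟨!![1, x; 0, 1], by simp⟩

/-- Lower elementary matrix. -/
def lower (x : R) : Matrix.SpecialLinearGroup (Fin 2) R := ⟨!![1, 0; x, 1], by simp⟩

lemma upper_add (x y : R) : upper (x + y) = upper x * upper y := by
  refine Matrix.SpecialLinearGroup.ext _ _ fun i j => ?_
  rw [two_by_two_mul]
  fin_cases i <;> fin_cases j <;> simp [upper, add_comm]

lemma lower_add (x y : R) : lower (x + y) = lower x * lower y := by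
  refine Matrix.SpecialLinearGroup.ext _ _ fun i j => ?_
  rw [two_by_two_mul]
  fin_cases i <;> fin_cases j <;> simp [lower]

lemma upper_natCast (n : ℕ) : upper (n : R) = upper 1 ^ n := by
  induction n with
  | zero =>
    rw [pow_zero]
    refine Matrix.SpecialLinearGroup.ext _ _ fun i j => ?_
    fin_cases i <;> fin_cases j <;> simp [upper]
  | succ n ih => rw [Nat.cast_succ, upper_add, ih, pow_succ]

lemma lower_natCast (n : ℕ) : lower (n : R) = lower 1 ^ n := by
  induction n with
  | zero =>
    rw [pow_zero]
    refine Matrix.SpecialLinearGroup.ext _ _ fun i j => ?_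
    fin_cases i <;> fin_cases j <;> simp [lower]
  | succ n ih => rw [Nat.cast_succ, lower_add, ih, pow_succ]

lemma eq_upper_mul_lower_mul_upper {F : Type*} [Field F]
    {g : Matrix.SpecialLinearGroup (Fin 2) F} (hg : g 1 0 ≠ 0) :
    g = upper ((g 0 0 - 1) / g 1 0) * lower (g 1 0) * upper ((g 1 1 - 1) / g 1 0) := by
  have hd := g.det_coe
  rw [Matrix.det_fin_two] at hd
  refine Matrix.SpecialLinearGroup.ext _ _ fun i j => ?_
  rw [two_by_two_mul, two_by_two_mul, two_by_two_mul]
  fin_cases i <;> fin_cases j <;> simp [upper, lower] <;> field_simp <;>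
    first | linear_combination -hd | ring1

/-- `SL₂(𝔽_p)` is generated by the two standard elementary matrices. -/
lemma eq_top_of_upper_mem_of_lower_mem {p : ℕ} [Fact p.Prime]
    {H : Subgroup (Matrix.SpecialLinearGroup (Fin 2) (ZMod p))}
    (hu : upper 1 ∈ H) (hl : lower 1 ∈ H) : H = ⊤ := by
  have hU : ∀ x : ZMod p, upper x ∈ H := fun x => by
    rw [← ZMod.natCast_zmod_val x, upper_natCast]
    exact pow_mem hu _
  have hL : ∀ x : ZMod p, lower x ∈ H := fun x => by
    rw [← ZMod.natCast_zmod_val x, lower_natCast]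
    exact pow_mem hl _
  have key : ∀ g : Matrix.SpecialLinearGroup (Fin 2) (ZMod p), g 1 0 ≠ 0 → g ∈ H := fun g hg => by
    rw [eq_upper_mul_lower_mul_upper hg]
    exact mul_mem (mul_mem (hU _) (hL _)) (hU _)
  refine (Subgroup.eq_top_iff' H).2 fun g => ?_
  by_cases hg : g 1 0 = 0
  · refine (H.mul_mem_cancel_left hl).1 (key _ ?_)
    have hd := g.det_coe
    rw [Matrix.det_fin_two, hg, mul_zero, sub_zero] at hd
    rw [two_by_two_mul, hg, mul_zero, add_zero]
    simpa [lower] using left_ne_zero_of_mul_eq_one hd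
  · exact key g hg

end Elementary

section Table

/-- Entries `(a, b, c, d)` of a `2 × 2` matrix over `ZMod n`, as natural numbers. -/
abbrev Quad := ℕ × ℕ × ℕ × ℕ

/-- Multiplication of matrices modulo `n`. -/
def Quad.mul (n : ℕ) : Quad → Quad → Quad
  | (a, b, c, d), (a', b', c', d') =>
    ((a * a' + b * c') % n, (a * b' + b * d') % n, (c * a' + d * c') % n, (c * b' + d * d') % n)

/-- A column of a matrix. -/
def Quad.col : Fin 2 → Quad → ℕ × ℕ
  | 0, (a, _, c, _) => (a, c)
  | 1, (_, b, _, d) => (b, d)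

variable {n : ℕ}

/-- The entries of a matrix in `SL₂(ZMod n)`, as natural numbers. -/
def code (g : Matrix.SpecialLinearGroup (Fin 2) (ZMod n)) : Quad :=
  ((g 0 0).val, (g 0 1).val, (g 1 0).val, (g 1 1).val)

lemma col_code (g : Matrix.SpecialLinearGroup (Fin 2) (ZMod n)) (j : Fin 2) :
    Quad.col j (code g) = ((g 0 j).val, (g 1 j).val) := by
  fin_cases j <;> rfl

variable [Fact n.Prime]

lemma code_injective : Function.Injective (code (n := n)) := by
  intro g h hgh
  simp only [code, Prod.mk.injEq, (ZMod.val_injective n).eq_iff] at hgh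
  refine Matrix.SpecialLinearGroup.ext _ _ fun i j => ?_
  fin_cases i <;> fin_cases j
  exacts [hgh.1, hgh.2.1, hgh.2.2.1, hgh.2.2.2]

lemma code_one : code (1 : Matrix.SpecialLinearGroup (Fin 2) (ZMod n)) = (1, 0, 0, 1) := by
  have : Fact (1 < n) := ⟨(Fact.out : n.Prime).one_lt⟩
  simp [code, ZMod.val_one]

lemma code_mul (g h : Matrix.SpecialLinearGroup (Fin 2) (ZMod n)) :
    code (g * h) = Quad.mul n (code g) (code h) := by
  simp only [code, Quad.mul, two_by_two_mul, ZMod.val_add, ZMod.val_mul, Nat.mod_add_mod,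
    Nat.add_mod_mod]

lemma code_pow (g : Matrix.SpecialLinearGroup (Fin 2) (ZMod n)) (k : ℕ) :
    code (g ^ k) = (Quad.mul n (code g))^[k] (1, 0, 0, 1) := by
  induction k with
  | zero => rw [pow_zero, code_one]; rfl
  | succ k ih => rw [pow_succ', code_mul, ih, Function.iterate_succ_apply']

/-- A valid code comes from a matrix. -/
lemma exists_code_eq {a b c d : ℕ} (ha : a < n) (hb : b < n) (hc : c < n) (hd : d < n)
    (hdet : (a * d) % n = (b * c + 1) % n) :
    ∃ g : Matrix.SpecialLinearGroup (Fin 2) (ZMod n), code g = (a, b, c, d) := by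
  have h := (ZMod.natCast_eq_natCast_iff' _ _ _).2 hdet
  push_cast at h
  refine ⟨⟨!![(a : ZMod n), b; c, d], by rw [Matrix.det_fin_two_of, h]; ring⟩, ?_⟩
  simp [code, ZMod.val_natCast, Nat.mod_eq_of_lt, *]

/-- `L` is the graph of an embedding `SL₂(𝔽_p) → SL₂(𝔽_q)` that sends the standard elementary
matrices to `s` and `t`, and whose image is transitive on the orbits of the coordinate points in
`ℙ¹(𝔽_q)`, with stabilizers consisting of the first four powers of `c`. -/
structure IsTable (p q : ℕ) (s t c : Quad) (L : List (Quad × Quad)) : Prop where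
  one_mem : ((1, 0, 0, 1), (1, 0, 0, 1)) ∈ L
  upper_mul_mem : ∀ l ∈ L, (Quad.mul p (1, 1, 0, 1) l.1, Quad.mul q s l.2) ∈ L
  lower_mul_mem : ∀ l ∈ L, (Quad.mul p (1, 0, 1, 1) l.1, Quad.mul q t l.2) ∈ L
  nodup_fst : (L.map Prod.fst).Nodup
  nodup_snd : (L.map Prod.snd).Nodup
  isCode : ∀ l ∈ L, l.1.1 < p ∧ l.1.2.1 < p ∧ l.1.2.2.1 < p ∧ l.1.2.2.2 < p ∧
    (l.1.1 * l.1.2.2.2) % p = (l.1.2.1 * l.1.2.2.1 + 1) % p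
  stabilizer : ∀ l ∈ L,
    (l.2.2.2.1 = 0 ↔ ∃ k ∈ List.range 4, (Quad.mul q c)^[k] (1, 0, 0, 1) = l.2) ∧
    (l.2.2.1 = 0 ↔ ∃ k ∈ List.range 4, (Quad.mul q c)^[k] (1, 0, 0, 1) = l.2)
  c_mem : c ∈ L.map Prod.snd
  c_pow_two : (Quad.mul q c)^[2] (1, 0, 0, 1) ≠ (1, 0, 0, 1)
  c_pow_four : (Quad.mul q c)^[4] (1, 0, 0, 1) = (1, 0, 0, 1)
  exists_col : ∀ j : Fin 2, ∀ m ∈ List.range q, ∃ l ∈ L,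
    (m * (l.2.col j).1 + (l.2.col j).2) % q = 0
  exists_col_zero : ∀ j : Fin 2, ∃ l ∈ L, (l.2.col j).1 = 0

lemma code_upper_one : code (upper (1 : ZMod n)) = (1, 1, 0, 1) := by
  have : Fact (1 < n) := ⟨(Fact.out : n.Prime).one_lt⟩
  simp [code, upper, ZMod.val_one]

lemma code_lower_one : code (lower (1 : ZMod n)) = (1, 0, 1, 1) := by
  have : Fact (1 < n) := ⟨(Fact.out : n.Prime).one_lt⟩
  simp [code, lower, ZMod.val_one]

lemma IsTable.code_mem {p q : ℕ} [Fact p.Prime] [Fact q.Prime] {L : List (Quad × Quad)}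
    {s t : Matrix.SpecialLinearGroup (Fin 2) (ZMod q)} {c : Quad}
    (h : IsTable p q (code s) (code t) c L)
    {x : Matrix.SpecialLinearGroup (Fin 2) (ZMod p) × Matrix.SpecialLinearGroup (Fin 2) (ZMod q)}
    (hx : x ∈ Subgroup.closure {(upper 1, s), (lower 1, t)}) : (code x.1, code x.2) ∈ L := by
  rw [← Subgroup.mem_toSubmonoid, Subgroup.closure_toSubmonoid_of_finite] at hx
  induction hx using Submonoid.closure_induction_left with
  | one =>
    rw [Prod.fst_one, Prod.snd_one, code_one, code_one]
    exact h.one_mem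
  | mul_left x hx y hy ih =>
    rw [Prod.fst_mul, Prod.snd_mul, code_mul, code_mul]
    rcases Set.mem_insert_iff.1 hx with hx | hx
    · rw [hx, code_upper_one]
      exact h.upper_mul_mem _ ih
    · rw [Set.mem_singleton_iff.1 hx, code_lower_one]
      exact h.lower_mul_mem _ ih

theorem IsTable.exists_isEdgePair {p q : ℕ} [Fact p.Prime] [Fact q.Prime] {L : List (Quad × Quad)}
    {s t c : Matrix.SpecialLinearGroup (Fin 2) (ZMod q)}
    (h : IsTable p q (code s) (code t) (code c) L) :
    ∃ A C : Subgroup (Matrix.SpecialLinearGroup (Fin 2) (ZMod q)), IsEdgePair A C ∧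
      Nonempty (A ≃* Matrix.SpecialLinearGroup (Fin 2) (ZMod p)) ∧ IsCyclic C ∧ Nat.card C = 4 := by
  obtain ⟨H, hH⟩ : ∃ H : Subgroup (Matrix.SpecialLinearGroup (Fin 2) (ZMod p) ×
      Matrix.SpecialLinearGroup (Fin 2) (ZMod q)),
      H = Subgroup.closure {(upper 1, s), (lower 1, t)} := ⟨_, rfl⟩
  have hu : (upper 1, s) ∈ H := by
    rw [hH]
    exact Subgroup.subset_closure (Set.mem_insert _ _)
  have hl : (lower 1, t) ∈ H := by
    rw [hH]
    exact Subgroup.subset_closure (Set.mem_insert_of_mem _ (Set.mem_singleton _))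
  have hfst : H.map (MonoidHom.fst _ _) = ⊤ := eq_top_of_upper_mem_of_lower_mem
    (Subgroup.mem_map_of_mem (MonoidHom.fst _ _) hu)
    (Subgroup.mem_map_of_mem (MonoidHom.fst _ _) hl)
  have hmem : ∀ x ∈ H, (code x.1, code x.2) ∈ L := fun x hx => h.code_mem (hH ▸ hx)
  have hsurj : ∀ l ∈ L, ∃ g ∈ H.map (MonoidHom.snd _ _), code g = l.2 := by
    rintro l hl
    obtain ⟨h1, h2, h3, h4, h5⟩ := h.isCode l hl
    obtain ⟨g, hg⟩ := exists_code_eq h1 h2 h3 h4 h5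
    obtain ⟨x, hx, rfl⟩ : g ∈ H.map (MonoidHom.fst _ _) := hfst ▸ Subgroup.mem_top g
    refine ⟨x.2, ⟨x, hx, rfl⟩, ?_⟩
    exact congrArg Prod.snd (List.inj_on_of_nodup_map h.nodup_fst (hmem x hx) hl hg)
  have hinj₁ : Function.Injective ((MonoidHom.fst _ _).subgroupMap H) := by
    rintro ⟨x, hx⟩ ⟨y, hy⟩ hxy
    have hxy' : x.1 = y.1 := congrArg Subtype.val hxy
    have := List.inj_on_of_nodup_map h.nodup_fst (hmem x hx) (hmem y hy) (congrArg code hxy')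
    exact Subtype.ext (Prod.ext hxy' (code_injective (congrArg Prod.snd this)))
  have hinj₂ : Function.Injective ((MonoidHom.snd _ _).subgroupMap H) := by
    rintro ⟨x, hx⟩ ⟨y, hy⟩ hxy
    have hxy' : x.2 = y.2 := congrArg Subtype.val hxy
    have := List.inj_on_of_nodup_map h.nodup_snd (hmem x hx) (hmem y hy) (congrArg code hxy')
    exact Subtype.ext (Prod.ext (code_injective (congrArg Prod.fst this)) hxy')
  have e₁ : H ≃* H.map (MonoidHom.fst _ _) :=
    MulEquiv.ofBijective _ ⟨hinj₁, MonoidHom.subgroupMap_surjective _ _⟩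
  have e₂ : H ≃* H.map (MonoidHom.snd _ _) :=
    MulEquiv.ofBijective _ ⟨hinj₂, MonoidHom.subgroupMap_surjective _ _⟩
  have hord : orderOf c = 4 := by
    refine orderOf_eq_prime_pow (p := 2) (n := 1) (fun h2 => h.c_pow_two ?_) ?_
    · rw [← code_pow, ← code_one (n := q)]
      exact congrArg code h2
    · refine code_injective ?_
      rw [code_one, code_pow]
      exact h.c_pow_four
  have hcA : c ∈ H.map (MonoidHom.snd _ _) := by
    obtain ⟨l, hl, hlc⟩ := List.mem_map.1 h.c_mem
    obtain ⟨g, hg, hgl⟩ := hsurj l hl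
    rwa [← code_injective (hgl.trans hlc)]
  have hC : ∀ g : Matrix.SpecialLinearGroup (Fin 2) (ZMod q),
      (∃ k ∈ List.range 4, (Quad.mul q (code c))^[k] (1, 0, 0, 1) = code g) ↔
      g ∈ Subgroup.zpowers c := by
    intro g
    classical
    rw [mem_zpowers_iff_mem_range_orderOf, hord]
    simp only [← code_pow, code_injective.eq_iff, List.mem_range, Finset.mem_image,
      Finset.mem_range]
  refine ⟨H.map (MonoidHom.snd _ _), Subgroup.zpowers c, ⟨?_, ?_, ?_, ?_⟩,
    ⟨e₂.symm.trans (e₁.trans ((MulEquiv.subgroupCongr hfst).trans Subgroup.topEquiv))⟩,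
    inferInstance, by rw [Nat.card_zpowers, hord]⟩
  · rwa [Subgroup.zpowers_le]
  · rintro _ ⟨x, hx, rfl⟩
    rw [← hC, ← (ZMod.val_eq_zero _)]
    exact (h.stabilizer _ (hmem x hx)).1
  · rintro _ ⟨x, hx, rfl⟩
    rw [← hC, ← (ZMod.val_eq_zero _)]
    exact (h.stabilizer _ (hmem x hx)).2
  · intro j x y
    by_cases hy : y = 0
    · obtain ⟨l, hl, hl0⟩ := h.exists_col_zero j
      obtain ⟨g, hg, hgl⟩ := hsurj l hl
      refine ⟨g, hg, ?_⟩
      rw [← hgl, col_code, ZMod.val_eq_zero] at hl0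
      rw [hl0, hy, mul_zero, zero_mul, add_zero]
    · obtain ⟨l, hl, hl0⟩ := h.exists_col j (x / y).val (List.mem_range.2 (ZMod.val_lt _))
      obtain ⟨g, hg, hgl⟩ := hsurj l hl
      refine ⟨g, hg, ?_⟩
      rw [← hgl, col_code, ← Nat.dvd_iff_mod_eq_zero, ← ZMod.natCast_eq_zero_iff] at hl0
      push_cast at hl0
      simp only [ZMod.natCast_zmod_val] at hl0
      field_simp at hl0
      linear_combination hl0

end Table

/-- The graph of an embedding `SL₂(𝔽₃) → SL₂(𝔽₅)`. -/
def tetrahedralTable : List (Quad × Quad) :=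
  [((1, 0, 0, 1), (1, 0, 0, 1)), ((1, 1, 0, 1), (3, 1, 2, 1)), ((1, 0, 1, 1), (1, 1, 2, 3)),
   ((1, 2, 0, 1), (1, 4, 3, 3)), ((1, 1, 1, 2), (0, 2, 2, 0)), ((2, 1, 1, 1), (0, 1, 4, 0)),
   ((1, 0, 2, 1), (3, 4, 3, 1)), ((1, 2, 1, 0), (4, 2, 1, 2)), ((2, 0, 1, 2), (2, 1, 2, 4)),
   ((1, 1, 2, 0), (2, 2, 1, 4)), ((0, 2, 1, 1), (4, 3, 4, 2)), ((2, 1, 0, 2), (4, 1, 2, 2)),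
   ((0, 1, 2, 1), (2, 3, 4, 4)), ((2, 2, 1, 0), (3, 3, 4, 1)), ((1, 2, 2, 2), (0, 4, 1, 0)),
   ((0, 2, 1, 2), (3, 2, 1, 1)), ((2, 0, 0, 2), (4, 0, 0, 4)), ((0, 1, 2, 0), (2, 0, 0, 3)),
   ((0, 2, 1, 0), (3, 0, 0, 2)), ((2, 1, 2, 0), (1, 3, 4, 3)), ((2, 2, 2, 1), (0, 3, 3, 0)),
   ((0, 1, 2, 2), (1, 2, 1, 3)), ((2, 2, 0, 2), (2, 4, 3, 4)), ((2, 0, 2, 2), (4, 4, 3, 2))]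

/-- The graph of an embedding `SL₂(𝔽₅) → SL₂(𝔽₂₉)`. -/
def icosahedralTable : List (Quad × Quad) :=
  [((1, 0, 0, 1), (1, 0, 0, 1)), ((1, 1, 0, 1), (3, 1, 1, 20)), ((1, 0, 1, 1), (20, 1, 1, 3)),
   ((1, 2, 0, 1), (10, 23, 23, 24)), ((1, 1, 1, 2), (3, 11, 6, 3)), ((2, 1, 1, 1), (3, 6, 11, 3)),
   ((1, 0, 2, 1), (24, 23, 23, 10)), ((1, 3, 0, 1), (24, 6, 6, 10)), ((1, 2, 1, 3), (20, 20, 21, 8)),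
   ((2, 3, 1, 2), (15, 7, 7, 13)), ((1, 1, 2, 3), (8, 20, 21, 20)), ((3, 2, 1, 1), (20, 21, 20, 8)),
   ((2, 1, 3, 2), (13, 7, 7, 15)), ((3, 1, 2, 1), (8, 21, 20, 20)), ((1, 0, 3, 1), (10, 6, 6, 24)),
   ((1, 4, 0, 1), (20, 28, 28, 3)), ((1, 3, 1, 4), (22, 14, 13, 7)), ((2, 0, 1, 3), (23, 10, 5, 6)),
   ((1, 2, 2, 0), (15, 2, 25, 15)), ((3, 0, 1, 2), (23, 5, 10, 6)), ((2, 3, 3, 0), (17, 8, 7, 17)),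
   ((3, 4, 2, 3), (16, 22, 22, 14)), ((1, 1, 3, 4), (7, 14, 13, 22)), ((4, 3, 1, 1), (22, 13, 14, 7)),
   ((3, 2, 4, 3), (14, 22, 22, 16)), ((0, 3, 3, 2), (17, 7, 8, 17)), ((2, 1, 0, 3), (6, 10, 5, 23)),
   ((0, 2, 2, 1), (15, 25, 2, 15)), ((3, 1, 0, 2), (6, 5, 10, 23)), ((4, 1, 3, 1), (7, 13, 14, 22)),
   ((1, 0, 4, 1), (3, 28, 28, 20)), ((1, 4, 1, 0), (22, 12, 17, 8)), ((2, 2, 1, 4), (21, 20, 21, 9)),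
   ((1, 3, 2, 2), (18, 26, 3, 6)), ((3, 3, 1, 3), (16, 7, 7, 14)), ((2, 0, 3, 3), (1, 3, 9, 28)),
   ((3, 2, 2, 0), (12, 21, 22, 12)), ((1, 2, 3, 2), (6, 26, 3, 18)), ((4, 2, 1, 2), (21, 21, 20, 9)),
   ((3, 0, 4, 2), (6, 19, 24, 23)), ((0, 3, 3, 0), (0, 12, 12, 0)), ((2, 3, 0, 3), (28, 3, 9, 1)),
   ((0, 2, 2, 3), (12, 22, 21, 12)), ((3, 4, 0, 2), (23, 19, 24, 6)), ((4, 0, 3, 4), (5, 6, 6, 19)),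
   ((1, 1, 4, 0), (8, 12, 17, 22)), ((0, 4, 1, 1), (22, 17, 12, 8)), ((4, 3, 0, 4), (19, 6, 6, 5)),
   ((2, 0, 4, 3), (6, 24, 19, 23)), ((3, 0, 3, 2), (1, 9, 3, 28)), ((2, 4, 0, 3), (23, 24, 19, 6)),
   ((2, 1, 2, 4), (9, 20, 21, 21)), ((2, 3, 2, 1), (18, 3, 26, 6)), ((3, 3, 0, 2), (28, 9, 3, 1)),
   ((3, 1, 3, 3), (14, 7, 7, 16)), ((2, 2, 3, 1), (6, 3, 26, 18)), ((4, 1, 2, 2), (9, 21, 20, 21)),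
   ((0, 1, 4, 1), (8, 17, 12, 22)), ((2, 4, 1, 0), (25, 15, 14, 27)), ((1, 4, 2, 4), (22, 16, 15, 7)),
   ((3, 1, 1, 4), (26, 11, 6, 26)), ((3, 0, 2, 2), (28, 26, 20, 1)), ((1, 3, 3, 0), (15, 4, 27, 15)),
   ((4, 1, 1, 3), (26, 6, 11, 26)), ((3, 3, 4, 1), (8, 9, 8, 20)), ((0, 3, 3, 3), (12, 8, 7, 12)),
   ((2, 0, 0, 3), (0, 1, 28, 0)), ((0, 2, 2, 0), (0, 17, 17, 0)), ((3, 2, 0, 2), (1, 26, 20, 28)),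
   ((4, 4, 3, 2), (21, 9, 8, 9)), ((1, 2, 4, 4), (7, 16, 15, 22)), ((0, 4, 1, 2), (25, 14, 15, 27)),
   ((4, 2, 0, 4), (5, 23, 23, 19)), ((2, 2, 4, 2), (13, 22, 22, 15)), ((3, 3, 3, 0), (12, 7, 8, 12)),
   ((2, 0, 2, 3), (28, 20, 26, 1)), ((3, 4, 3, 1), (20, 9, 8, 8)), ((2, 4, 3, 4), (21, 8, 9, 9)),
   ((4, 0, 2, 4), (19, 23, 23, 5)), ((0, 1, 4, 0), (12, 0, 0, 17)), ((0, 4, 1, 0), (17, 0, 0, 12)),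
   ((4, 3, 4, 2), (9, 9, 8, 21)), ((1, 3, 4, 3), (8, 8, 9, 20)), ((2, 2, 0, 3), (1, 20, 26, 28)),
   ((2, 4, 2, 2), (15, 22, 22, 13)), ((2, 1, 4, 0), (27, 15, 14, 25)), ((4, 4, 2, 1), (22, 15, 16, 7)),
   ((2, 3, 4, 4), (9, 8, 9, 21)), ((3, 0, 0, 2), (0, 28, 1, 0)), ((1, 4, 3, 3), (20, 8, 9, 8)),
   ((0, 3, 3, 1), (15, 27, 4, 15)), ((4, 2, 4, 1), (7, 15, 16, 22)), ((0, 1, 4, 2), (27, 14, 15, 25)),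
   ((3, 4, 1, 0), (2, 14, 15, 4)), ((3, 3, 2, 4), (23, 26, 3, 11)), ((4, 0, 1, 4), (26, 1, 1, 9)),
   ((3, 1, 4, 0), (4, 14, 15, 2)), ((0, 2, 2, 2), (17, 21, 22, 17)), ((4, 3, 3, 0), (14, 27, 4, 14)),
   ((0, 4, 1, 3), (2, 15, 14, 4)), ((4, 1, 0, 4), (9, 1, 1, 26)), ((2, 4, 4, 1), (3, 18, 23, 3)),
   ((2, 2, 2, 0), (17, 22, 21, 17)), ((3, 2, 3, 4), (11, 26, 3, 23)), ((0, 1, 4, 4), (7, 12, 17, 21)),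
   ((1, 4, 4, 2), (3, 23, 18, 3)), ((4, 3, 2, 3), (23, 3, 26, 11)), ((0, 3, 3, 4), (14, 4, 27, 14)),
   ((4, 1, 4, 0), (7, 17, 12, 21)), ((0, 4, 1, 4), (21, 12, 17, 7)), ((0, 1, 4, 3), (4, 15, 14, 2)),
   ((4, 4, 1, 0), (21, 17, 12, 7)), ((4, 2, 3, 3), (11, 3, 26, 23)), ((3, 4, 4, 4), (26, 23, 18, 26)),
   ((0, 2, 2, 4), (14, 2, 25, 14)), ((4, 0, 0, 4), (28, 0, 0, 28)), ((4, 2, 2, 0), (14, 25, 2, 14)),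
   ((4, 0, 4, 4), (9, 28, 28, 26)), ((4, 4, 4, 3), (26, 18, 23, 26)), ((4, 4, 0, 4), (26, 28, 28, 9))]

lemma isTable_tetrahedralTable :
    IsTable 3 5 (3, 1, 2, 1) (1, 1, 2, 3) (2, 0, 0, 3) tetrahedralTable := by
  constructor <;> decide +kernel

lemma isTable_icosahedralTable :
    IsTable 5 29 (3, 1, 1, 20) (20, 1, 1, 3) (12, 0, 0, 17) icosahedralTable := by
  constructor <;> decide +kernel

end SL2Lattice

/-- Over `K = 𝔽₅((u))` there are finite subgroups `A₁, A₂ ≤ SL₂(K)`,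
each isomorphic to `SL₂(𝔽₃)`, with `A₁ ∩ A₂` cyclic of order `4`, generating a discrete
cocompact subgroup; over `K = 𝔽₂₉((u))` the same holds with `A_i ≅ SL₂(𝔽₅)`. -/
theorem exceptional_lattices_q_five_and_twentynine :
    (∃ A₁ A₂ : Subgroup (Matrix.SpecialLinearGroup (Fin 2) (LaurentSeries (ZMod 5))),
      Finite A₁ ∧ Finite A₂ ∧
      Nonempty (A₁ ≃* Matrix.SpecialLinearGroup (Fin 2) (ZMod 3)) ∧
      Nonempty (A₂ ≃* Matrix.SpecialLinearGroup (Fin 2) (ZMod 3)) ∧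
      IsCyclic ↥(A₁ ⊓ A₂) ∧ Nat.card ↥(A₁ ⊓ A₂) = 4 ∧
      DiscreteTopology (Subgroup.closure ((↑A₁ ∪ ↑A₂) :
        Set (Matrix.SpecialLinearGroup (Fin 2) (LaurentSeries (ZMod 5))))) ∧
      CompactSpace (Matrix.SpecialLinearGroup (Fin 2) (LaurentSeries (ZMod 5)) ⧸
        Subgroup.closure ((↑A₁ ∪ ↑A₂) :
          Set (Matrix.SpecialLinearGroup (Fin 2) (LaurentSeries (ZMod 5)))))) ∧
    (∃ A₁ A₂ : Subgroup (Matrix.SpecialLinearGroup (Fin 2) (LaurentSeries (ZMod 29))),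
      Finite A₁ ∧ Finite A₂ ∧
      Nonempty (A₁ ≃* Matrix.SpecialLinearGroup (Fin 2) (ZMod 5)) ∧
      Nonempty (A₂ ≃* Matrix.SpecialLinearGroup (Fin 2) (ZMod 5)) ∧
      IsCyclic ↥(A₁ ⊓ A₂) ∧ Nat.card ↥(A₁ ⊓ A₂) = 4 ∧
      DiscreteTopology (Subgroup.closure ((↑A₁ ∪ ↑A₂) :
        Set (Matrix.SpecialLinearGroup (Fin 2) (LaurentSeries (ZMod 29))))) ∧
      CompactSpace (Matrix.SpecialLinearGroup (Fin 2) (LaurentSeries (ZMod 29)) ⧸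
        Subgroup.closure ((↑A₁ ∪ ↑A₂) :
          Set (Matrix.SpecialLinearGroup (Fin 2) (LaurentSeries (ZMod 29)))))) := by
  constructor
  · obtain ⟨A, C, h, ⟨e⟩, hC, hcard⟩ :=
      SL2Lattice.IsTable.exists_isEdgePair (p := 3) (q := 5)
        (s := ⟨!![3, 1; 2, 1], by decide⟩) (t := ⟨!![1, 1; 2, 3], by decide⟩)
        (c := ⟨!![2, 0; 0, 3], by decide⟩) SL2Lattice.isTable_tetrahedralTable
    exact h.exists_lattice e hcard
  · obtain ⟨A, C, h, ⟨e⟩, hC, hcard⟩ :=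
      SL2Lattice.IsTable.exists_isEdgePair (p := 5) (q := 29)
        (s := ⟨!![3, 1; 1, 20], by decide⟩) (t := ⟨!![20, 1; 1, 3], by decide⟩)
        (c := ⟨!![12, 0; 0, 17], by decide⟩) SL2Lattice.isTable_icosahedralTable
    exact h.exists_lattice e hcard
end
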